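/- arXiv:2209.08039 — 11 statements merged into one kernel-verified Lean document; each statement's English description precedes it below -/
import Mathlib

section
/- Let n be a positive integer and let E = {(I_α, J_α)}_{α=1,…,m} and E' = {(I'_β, J'_β)}_{β=1,…,m'} be finite collections of pairs of subsets of {1,…,n}. Suppose the set S_{E'} is nonempty and is contained in the topological closure of S_E (with respect to the Euclidean topology on symmetric matrices). Then for every α ∈ {1,…,m} there exists β ∈ {1,…,m'} such that I'_β ⊆ I_α and J_α ⊆ J'_β. -/
open Matrix

/-- The copositive cone. -/
def Copositive (n : ℕ) : Set (Matrix (Fin n) (Fin n) ℝ) :=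
  {A | A.IsSymm ∧ ∀ x : Fin n → ℝ, (∀ i, 0 ≤ x i) → 0 ≤ x ⬝ᵥ A *ᵥ x}

/-- A zero of a copositive matrix. -/
def IsZeroOf {n : ℕ} (A : Matrix (Fin n) (Fin n) ℝ) (x : Fin n → ℝ) : Prop :=
  x ≠ 0 ∧ (∀ i, 0 ≤ x i) ∧ x ⬝ᵥ A *ᵥ x = 0

/-- Support of a vector. -/
def supp {n : ℕ} (x : Fin n → ℝ) : Set (Fin n) := {i | 0 < x i}

/-- Minimal zeros. -/
def IsMinimalZero {n : ℕ} (A : Matrix (Fin n) (Fin n) ℝ) (u : Fin n → ℝ) : Prop :=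
  IsZeroOf A u ∧ ∀ v : Fin n → ℝ, IsZeroOf A v → ¬ supp v ⊂ supp u

/-- Complementary index set of a zero. -/
def compSet {n : ℕ} (A : Matrix (Fin n) (Fin n) ℝ) (u : Fin n → ℝ) : Set (Fin n) :=
  {i | (A *ᵥ u) i = 0}

/-- Extended minimal zero support set. -/
def eSupp {n : ℕ} (A : Matrix (Fin n) (Fin n) ℝ) : Set (Set (Fin n) × Set (Fin n)) :=
  {p | ∃ u : Fin n → ℝ, IsMinimalZero A u ∧ p = (supp u, compSet A u)}

/-- `S_E` for the collection `E = {(I α, J α)}_{α}`. -/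
def SE (n m : ℕ) (I J : Fin m → Set (Fin n)) : Set (Matrix (Fin n) (Fin n) ℝ) :=
  {A | A ∈ Copositive n ∧ eSupp A = {p | ∃ α : Fin m, p = (I α, J α)}}

/-- A zero of a copositive matrix is mapped to a nonnegative vector. -/
lemma IsZeroOf.mulVec_nonneg {n : ℕ} {A : Matrix (Fin n) (Fin n) ℝ} (hA : A ∈ Copositive n)
    {u : Fin n → ℝ} (hu : IsZeroOf A u) (i : Fin n) : 0 ≤ (A *ᵥ u) i := by
  obtain ⟨hsymm, hcop⟩ := hA
  obtain ⟨-, hpos, hzero⟩ := hu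
  have key (t : ℝ) (ht : 0 ≤ t) : 0 ≤ 2 * t * (A *ᵥ u) i + t ^ 2 * A i i := by
    have h := hcop (u + t • Pi.single i 1) fun j ↦ by
      by_cases hj : j = i
      · subst hj
        simpa using add_nonneg (hpos j) ht
      · simpa [hj] using hpos j
    have hcomm : u ⬝ᵥ A.col i = (A *ᵥ u) i := by
      rw [dotProduct_comm]
      conv_rhs => rw [← hsymm.eq]
      rfl
    simp only [mulVec_add, mulVec_smul, add_dotProduct, dotProduct_add, smul_dotProduct,
      dotProduct_smul, hzero, mulVec_single_one, single_one_dotProduct, smul_eq_mul, hcomm,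
      col_apply] at h
    linarith
  by_contra! hneg
  have hdiag : 0 < |A i i| + 1 := by positivity
  have ht : 0 < -(A *ᵥ u) i / (|A i i| + 1) := div_pos (by linarith) hdiag
  have h := key _ ht.le
  set t := -(A *ᵥ u) i / (|A i i| + 1) with ht_def
  have htmul : t * (|A i i| + 1) = -(A *ᵥ u) i := div_mul_cancel₀ _ hdiag.ne'
  have hle : t * A i i ≤ t * |A i i| := mul_le_mul_of_nonneg_left (le_abs_self _) ht.le
  nlinarith

/-- The support of a zero of a copositive matrix is contained in its complementary index set. -/
lemma IsZeroOf.supp_subset_compSet {n : ℕ} {A : Matrix (Fin n) (Fin n) ℝ}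
    (hA : A ∈ Copositive n) {u : Fin n → ℝ} (hu : IsZeroOf A u) : supp u ⊆ compSet A u := by
  intro i hi
  have h := (Finset.sum_eq_zero_iff_of_nonneg fun j _ ↦
    mul_nonneg (hu.2.1 j) (hu.mulVec_nonneg hA j)).1 hu.2.2 i (Finset.mem_univ i)
  exact (mul_eq_zero.1 h).resolve_left (ne_of_gt hi)

/-- Complementary index sets of zeros of a copositive matrix are antitone in the support. -/
lemma IsZeroOf.compSet_subset_of_supp_subset {n : ℕ} {A : Matrix (Fin n) (Fin n) ℝ}
    (hA : A ∈ Copositive n) {u v : Fin n → ℝ} (hu : IsZeroOf A u) (hv : IsZeroOf A v)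
    (hvu : supp v ⊆ supp u) : compSet A u ⊆ compSet A v := by
  have hexists : ∃ ε > 0, ∀ i, ε * v i ≤ u i := by
    have h (i : Fin n) : ∀ᶠ ε in nhdsWithin (0 : ℝ) (Set.Ioi 0), ε * v i ≤ u i := by
      by_cases hi : 0 < v i
      · have hc : Filter.Tendsto (fun ε : ℝ ↦ ε * v i) (nhdsWithin 0 (Set.Ioi 0)) (nhds 0) := by
          have : Continuous fun ε : ℝ ↦ ε * v i := by fun_prop
          simpa using (this.tendsto 0).mono_left nhdsWithin_le_nhds
        exact (hc.eventually_lt_const (hvu hi)).mono fun _ ↦ le_of_lt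
      · have hvi : v i = 0 := le_antisymm (not_lt.1 hi) (hv.2.1 i)
        simp [hvi, hu.2.1 i]
    obtain ⟨ε, hε, hpos⟩ := ((Filter.eventually_all.2 h).and self_mem_nhdsWithin).exists
    exact ⟨ε, hpos, hε⟩
  obtain ⟨ε, hε, hle⟩ := hexists
  have hvAu : v ⬝ᵥ A *ᵥ u = 0 := Finset.sum_eq_zero fun i _ ↦ by
    by_cases hi : 0 < v i
    · exact mul_eq_zero_of_right _ (hu.supp_subset_compSet hA (hvu hi))
    · exact mul_eq_zero_of_left (le_antisymm (not_lt.1 hi) (hv.2.1 i)) _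
  have huAv : u ⬝ᵥ A *ᵥ v = 0 := by
    rw [dotProduct_mulVec, ← mulVec_transpose, hA.1.eq, dotProduct_comm, hvAu]
  have hw (j : Fin n) : 0 ≤ (A *ᵥ (u - ε • v)) j := by
    by_cases h0 : u - ε • v = 0
    · simp [h0]
    · refine IsZeroOf.mulVec_nonneg hA ⟨h0, fun i ↦ ?_, ?_⟩ j
      · simpa using hle i
      · simp [mulVec_sub, mulVec_smul, hu.2.2, hv.2.2, hvAu, huAv]
  intro j hj
  have h1 := hw j
  have h2 := hv.mulVec_nonneg hA j
  have hj' : (A *ᵥ u) j = 0 := hj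
  simp only [mulVec_sub, mulVec_smul, Pi.sub_apply, Pi.smul_apply, smul_eq_mul, hj'] at h1
  exact le_antisymm (by nlinarith) h2

/-- Every zero dominates a minimal zero. -/
lemma IsZeroOf.exists_isMinimalZero {n : ℕ} {A : Matrix (Fin n) (Fin n) ℝ} {u : Fin n → ℝ}
    (hu : IsZeroOf A u) : ∃ v, IsMinimalZero A v ∧ supp v ⊆ supp u := by
  obtain ⟨s, hs, hmin⟩ := (Set.toFinite (supp '' {v | IsZeroOf A v})).exists_le_minimal
    (Set.mem_image_of_mem supp hu)
  obtain ⟨v, hv, rfl⟩ := hmin.prop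
  exact ⟨v, ⟨hv, fun w hw hlt ↦ hlt.not_subset (hmin.le_of_le ⟨w, hw, rfl⟩ hlt.subset)⟩, hs⟩

/-- The matrices possessing a normalized zero with support in `I` and complementary index set
containing `J` form a closed set. -/
lemma isClosed_exists_zero (n : ℕ) (I J : Set (Fin n)) :
    IsClosed {A : Matrix (Fin n) (Fin n) ℝ | ∃ x ∈ stdSimplex ℝ (Fin n),
      x ⬝ᵥ A *ᵥ x = 0 ∧ (∀ i ∉ I, x i = 0) ∧ ∀ j ∈ J, (A *ᵥ x) j = 0} := by
  have : CompactSpace (stdSimplex ℝ (Fin n)) :=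
    isCompact_iff_compactSpace.1 (isCompact_stdSimplex ℝ (Fin n))
  have hclosed : IsClosed {p : stdSimplex ℝ (Fin n) × Matrix (Fin n) (Fin n) ℝ |
      p.1.1 ⬝ᵥ p.2 *ᵥ p.1.1 = 0 ∧ (∀ i ∉ I, p.1.1 i = 0) ∧ ∀ j ∈ J, (p.2 *ᵥ p.1.1) j = 0} := by
    have hx : Continuous fun p : stdSimplex ℝ (Fin n) × Matrix (Fin n) (Fin n) ℝ ↦ p.1.1 := by
      fun_prop
    have hAx := continuous_snd.matrix_mulVec hx
    simp only [Set.ofPred_and, Set.ofPred_forall]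
    refine (isClosed_eq (hx.dotProduct hAx) continuous_const).inter (.inter ?_ ?_)
    · exact isClosed_iInter fun i ↦ isClosed_iInter fun _ ↦
        isClosed_eq ((continuous_apply i).comp hx) continuous_const
    · exact isClosed_iInter fun j ↦ isClosed_iInter fun _ ↦
        isClosed_eq ((continuous_apply j).comp hAx) continuous_const
  convert isClosedMap_snd_of_compactSpace _ hclosed using 1
  ext A
  simp
  grind

/-- A zero can be rescaled to lie in the standard simplex. -/
lemma IsZeroOf.exists_mem_stdSimplex {n : ℕ} {A : Matrix (Fin n) (Fin n) ℝ} {u : Fin n → ℝ}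
    (hu : IsZeroOf A u) : ∃ x ∈ stdSimplex ℝ (Fin n), x ⬝ᵥ A *ᵥ x = 0 ∧
      (∀ i ∉ supp u, x i = 0) ∧ ∀ j ∈ compSet A u, (A *ᵥ x) j = 0 := by
  obtain ⟨hne, hpos, hzero⟩ := hu
  have hsum : 0 ≤ ∑ i, u i := Finset.sum_nonneg fun i _ ↦ hpos i
  have hsum_ne : ∑ i, u i ≠ 0 := fun h ↦
    hne (funext fun i ↦ (Finset.sum_eq_zero_iff_of_nonneg fun i _ ↦ hpos i).1 h i (by simp))
  refine ⟨(∑ i, u i)⁻¹ • u, ⟨fun i ↦ mul_nonneg (inv_nonneg.2 hsum) (hpos i), ?_⟩, ?_, ?_, ?_⟩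
  · simp [← Finset.mul_sum, hsum_ne]
  · simp [mulVec_smul, hzero]
  · intro i hi
    have hui : u i = 0 := le_antisymm (not_lt.1 hi) (hpos i)
    simp [hui]
  · intro j hj
    have hj' : (A *ᵥ u) j = 0 := hj
    simp [mulVec_smul, hj']

theorem closure_component_support_inclusion
    (n : ℕ) (hn : 0 < n) (m m' : ℕ)
    (I J : Fin m → Set (Fin n)) (I' J' : Fin m' → Set (Fin n))
    (hne : (SE n m' I' J').Nonempty)
    (hsub : SE n m' I' J' ⊆ closure (SE n m I J)) :
    ∀ α : Fin m, ∃ β : Fin m', I' β ⊆ I α ∧ J α ⊆ J' β := by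
  intro α
  obtain ⟨A, hA, hE'⟩ := hne
  have hSE : SE n m I J ⊆ {A | ∃ x ∈ stdSimplex ℝ (Fin n),
      x ⬝ᵥ A *ᵥ x = 0 ∧ (∀ i ∉ I α, x i = 0) ∧ ∀ j ∈ J α, (A *ᵥ x) j = 0} := by
    rintro B ⟨-, hE⟩
    have hmem : (I α, J α) ∈ eSupp B := hE ▸ ⟨α, rfl⟩
    obtain ⟨u, hu, huα⟩ := hmem
    obtain ⟨hI, hJ⟩ := Prod.mk.inj huα
    simpa only [Set.mem_ofPred_eq, hI, hJ] using hu.1.exists_mem_stdSimplex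
  obtain ⟨x, hx, hzero, hxI, hxJ⟩ :=
    closure_minimal hSE (isClosed_exists_zero n (I α) (J α)) (hsub ⟨hA, hE'⟩)
  have hxA : IsZeroOf A x := by
    refine ⟨?_, hx.1, hzero⟩
    rintro rfl
    simpa using hx.2
  obtain ⟨v, hv, hvx⟩ := hxA.exists_isMinimalZero
  have hmem : (supp v, compSet A v) ∈ eSupp A := ⟨v, hv, rfl⟩
  rw [hE'] at hmem
  obtain ⟨β, hβ⟩ := hmem
  obtain ⟨hI, hJ⟩ := Prod.mk.inj hβ
  refine ⟨β, hI ▸ hvx.trans fun i hi ↦ ?_, hJ ▸ fun j hj ↦ ?_⟩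
  · by_contra hiI
    exact (ne_of_gt hi) (hxI i hiI)
  · exact hxA.compSet_subset_of_supp_subset hA hv.1 hvx (hxJ j hj)
end

section
/- Let A be a real symmetric n×n matrix belonging to the Parrilo cone K_n^(1), and let Λ¹,…,Λⁿ be symmetric matrices witnessing this membership, i.e., for all i the matrix Mⁱ := A − Λⁱ is positive semidefinite and Λⁱ_{ii} = 0, for all i ≠ j one has Λⁱ_{jj} + 2Λʲ_{ij} = 0, and for all pairwise distinct i, j, k one has Λⁱ_{jk} + Λʲ_{ik} + Λᵏ_{ij} ≥ 0. If x is a zero of A (a nonzero entrywise nonnegative vector with xᵀAx = 0), then Mⁱ x = 0 for every index i with xᵢ > 0. -/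
open Matrix

/-- The symmetrization of a Parrilo certificate is nonnegative on all index triples, including
those with repeated indices, where it vanishes. -/
lemma parrilo_symmetrization_nonneg {ι R : Type*} [CommRing R] [PartialOrder R]
    (Λ : ι → Matrix ι ι R)
    (hΛsym : ∀ i, (Λ i).IsSymm)
    (hdiag : ∀ i, Λ i i i = 0)
    (hmix : ∀ i j : ι, i ≠ j → Λ i j j + 2 * Λ j i j = 0)
    (hm : ∀ i j k : ι, i ≠ j → i ≠ k → j ≠ k → 0 ≤ Λ i j k + Λ j i k + Λ k i j)
    (i j k : ι) : 0 ≤ Λ i j k + Λ j i k + Λ k i j := by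
  have hpair (i j : ι) : Λ i j j + 2 * Λ j i j = 0 := by
    by_cases h : i = j
    · subst h
      simp [hdiag]
    · exact hmix i j h
  by_cases hij : i = j
  · subst hij
    rw [(hΛsym i).apply k i]
    exact (by linear_combination hpair k i :
      Λ i k i + Λ i k i + Λ k i i = 0).ge
  by_cases hik : i = k
  · subst hik
    rw [(hΛsym i).apply j i]
    exact (by linear_combination hpair j i :
      Λ i j i + Λ j i i + Λ i j i = 0).ge
  by_cases hjk : j = k
  · subst hjk
    exact (by linear_combination hpair i j :
      Λ i j j + Λ j i j + Λ j i j = 0).ge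
  exact hm i j k hij hik hjk

/-- If the symmetrization of a family of matrices is nonnegative, then so is the associated cubic
form on the nonnegative orthant. -/
lemma cubic_form_nonneg_of_symmetrization_nonneg {ι R : Type*} [Fintype ι] [CommRing R]
    [LinearOrder R] [IsStrictOrderedRing R] (Λ : ι → Matrix ι ι R)
    (hm : ∀ i j k : ι, 0 ≤ Λ i j k + Λ j i k + Λ k i j)
    (x : ι → R) (hx : ∀ i, 0 ≤ x i) :
    0 ≤ ∑ i, x i * (x ⬝ᵥ Λ i *ᵥ x) := by
  have hexpand : ∑ i, x i * (x ⬝ᵥ Λ i *ᵥ x) =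
      ∑ i, ∑ j, ∑ k, Λ i j k * (x i * x j * x k) := by
    simp only [dotProduct, mulVec, Finset.mul_sum]
    refine Finset.sum_congr rfl fun i _ ↦ Finset.sum_congr rfl fun j _ ↦
      Finset.sum_congr rfl fun k _ ↦ ?_
    ring
  have hswap : ∑ i, ∑ j, ∑ k, Λ j i k * (x i * x j * x k) =
      ∑ i, ∑ j, ∑ k, Λ i j k * (x i * x j * x k) := by
    rw [Finset.sum_comm]
    simp only [mul_comm (x _) (x _)]
  have hcycle : ∑ i, ∑ j, ∑ k, Λ k i j * (x i * x j * x k) =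
      ∑ i, ∑ j, ∑ k, Λ i j k * (x i * x j * x k) := by
    rw [Finset.sum_congr rfl fun i _ ↦ Finset.sum_comm, Finset.sum_comm]
    refine Finset.sum_congr rfl fun i _ ↦ Finset.sum_congr rfl fun j _ ↦
      Finset.sum_congr rfl fun k _ ↦ ?_
    ring
  have hsum : 0 ≤ ∑ i, ∑ j, ∑ k, (Λ i j k + Λ j i k + Λ k i j) * (x i * x j * x k) :=
    Finset.sum_nonneg fun i _ ↦ Finset.sum_nonneg fun j _ ↦ Finset.sum_nonneg fun k _ ↦
      mul_nonneg (hm i j k) (mul_nonneg (mul_nonneg (hx i) (hx j)) (hx k))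
  simp only [add_mul, Finset.sum_add_distrib, hswap, hcycle] at hsum
  rw [hexpand]
  linarith

theorem parrilo_zero_in_kernel
    (n : ℕ) (A : Matrix (Fin n) (Fin n) ℝ) (hA : A.IsSymm)
    (Λ : Fin n → Matrix (Fin n) (Fin n) ℝ)
    (hΛsym : ∀ i, (Λ i).IsSymm)
    (hpsd : ∀ i, (A - Λ i).PosSemidef)
    (hdiag : ∀ i, Λ i i i = 0)
    (hmix : ∀ i j : Fin n, i ≠ j → Λ i j j + 2 * Λ j i j = 0)
    (hm : ∀ i j k : Fin n, i ≠ j → i ≠ k → j ≠ k →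
      0 ≤ Λ i j k + Λ j i k + Λ k i j)
    (x : Fin n → ℝ) (hx0 : x ≠ 0) (hxnn : ∀ i, 0 ≤ x i)
    (hxz : x ⬝ᵥ A *ᵥ x = 0) :
    ∀ i : Fin n, 0 < x i → (A - Λ i) *ᵥ x = 0 := by
  intro i hi
  have hcubic := cubic_form_nonneg_of_symmetrization_nonneg Λ
    (parrilo_symmetrization_nonneg Λ hΛsym hdiag hmix hm) x hxnn
  have hquad (j : Fin n) : x ⬝ᵥ (A - Λ j) *ᵥ x = -(x ⬝ᵥ Λ j *ᵥ x) := by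
    rw [sub_mulVec, dotProduct_sub, hxz, zero_sub]
  have hnonneg (j : Fin n) : 0 ≤ x ⬝ᵥ (A - Λ j) *ᵥ x := by
    simpa using (hpsd j).dotProduct_mulVec_nonneg x
  have hterm : ∀ j ∈ Finset.univ, 0 ≤ x j * (x ⬝ᵥ (A - Λ j) *ᵥ x) :=
    fun j _ ↦ mul_nonneg (hxnn j) (hnonneg j)
  have hsum : ∑ j, x j * (x ⬝ᵥ (A - Λ j) *ᵥ x) = 0 := by
    refine le_antisymm ?_ (Finset.sum_nonneg hterm)
    simpa [hquad] using hcubic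
  have hzero := (Finset.sum_eq_zero_iff_of_nonneg hterm).mp hsum i (Finset.mem_univ i)
  rw [← (hpsd i).dotProduct_mulVec_zero_iff, star_trivial]
  exact (mul_eq_zero.mp hzero).resolve_left hi.ne'
end

section
/- Let A ∈ COP_n also belong to the Parrilo cone K_n^(1), with symmetric matrices Λ¹,…,Λⁿ witnessing membership in K_n^(1), and set Mⁱ := A − Λⁱ. Let x^α and x^β be minimal zeros of A with extended supports (I_α, J_α) and (I_β, J_β) respectively, i.e., I_α = Supp(x^α), J_α = Comp(x^α), I_β = Supp(x^β), J_β = Comp(x^β). If I_α ∪ I_β ⊆ J_α ∩ J_β, then Mⁱ x^α = 0 for every i ∈ I_α ∪ I_β. -/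
open Matrix

/-- The cubic form of a Parrilo certificate is nonnegative on the nonnegative orthant. -/
lemma parrilo_cubic_nonneg {n : ℕ} (Λ : Fin n → Matrix (Fin n) (Fin n) ℝ)
    (hΛsym : ∀ i, (Λ i).IsSymm)
    (hdiag : ∀ i, Λ i i i = 0)
    (hmix : ∀ i j : Fin n, i ≠ j → Λ i j j + 2 * Λ j i j = 0)
    (hm : ∀ i j k : Fin n, i ≠ j → i ≠ k → j ≠ k →
      0 ≤ Λ i j k + Λ j i k + Λ k i j)
    {x : Fin n → ℝ} (hx : ∀ i, 0 ≤ x i) :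
    0 ≤ ∑ i, x i * (x ⬝ᵥ Λ i *ᵥ x) := by
  have hcoeff : ∀ i j k, 0 ≤ Λ i j k + Λ j i k + Λ k i j := by
    intro i j k
    have hs : ∀ a b c, Λ a b c = Λ a c b := fun a b c => (hΛsym a).apply c b
    by_cases hij : i = j
    · subst hij
      by_cases hik : i = k
      · subst hik
        simp [hdiag]
      · linarith [hmix k i (Ne.symm hik), hs i i k]
    · by_cases hik : i = k
      · subst hik
        linarith [hmix j i (Ne.symm hij), hs i i j]
      · by_cases hjk : j = k
        · subst hjk
          linarith [hmix i j hij]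
        · exact hm i j k hij hik hjk
  have hexpand : ∑ i, x i * (x ⬝ᵥ Λ i *ᵥ x) = ∑ i, ∑ j, ∑ k, Λ i j k * (x i * x j * x k) := by
    simp only [dotProduct, mulVec, Finset.mul_sum]
    refine Finset.sum_congr rfl fun i _ => Finset.sum_congr rfl fun j _ =>
      Finset.sum_congr rfl fun k _ => by ring
  have hswap : ∑ i, ∑ j, ∑ k, Λ j i k * (x i * x j * x k)
      = ∑ i, ∑ j, ∑ k, Λ i j k * (x i * x j * x k) := by
    rw [Finset.sum_comm]
    refine Finset.sum_congr rfl fun i _ => Finset.sum_congr rfl fun j _ =>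
      Finset.sum_congr rfl fun k _ => by ring
  have hrotate : ∑ i, ∑ j, ∑ k, Λ k i j * (x i * x j * x k)
      = ∑ i, ∑ j, ∑ k, Λ i j k * (x i * x j * x k) := by
    rw [← hswap]
    refine Finset.sum_congr rfl fun i _ => ?_
    rw [Finset.sum_comm]
    refine Finset.sum_congr rfl fun j _ => Finset.sum_congr rfl fun k _ => by ring
  have hnonneg : 0 ≤ ∑ i, ∑ j, ∑ k, (Λ i j k + Λ j i k + Λ k i j) * (x i * x j * x k) :=
    Finset.sum_nonneg fun i _ => Finset.sum_nonneg fun j _ => Finset.sum_nonneg fun k _ =>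
      mul_nonneg (hcoeff i j k) (mul_nonneg (mul_nonneg (hx i) (hx j)) (hx k))
  simp only [add_mul, Finset.sum_add_distrib] at hnonneg
  rw [hswap, hrotate] at hnonneg
  rw [hexpand]
  linarith

/-- A nonnegative isotropic vector `x` of `A` is in the kernel of `A - Λ i` for `i` in its
support. -/
lemma parrilo_mulVec_eq_zero {n : ℕ} {A : Matrix (Fin n) (Fin n) ℝ}
    (Λ : Fin n → Matrix (Fin n) (Fin n) ℝ)
    (hΛsym : ∀ i, (Λ i).IsSymm)
    (hpsd : ∀ i, (A - Λ i).PosSemidef)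
    (hdiag : ∀ i, Λ i i i = 0)
    (hmix : ∀ i j : Fin n, i ≠ j → Λ i j j + 2 * Λ j i j = 0)
    (hm : ∀ i j k : Fin n, i ≠ j → i ≠ k → j ≠ k →
      0 ≤ Λ i j k + Λ j i k + Λ k i j)
    {x : Fin n → ℝ} (hx : ∀ i, 0 ≤ x i) (hzero : x ⬝ᵥ A *ᵥ x = 0) {i : Fin n} (hi : 0 < x i) :
    (A - Λ i) *ᵥ x = 0 := by
  have hpsd_nonneg : ∀ j, 0 ≤ x ⬝ᵥ (A - Λ j) *ᵥ x := fun j => by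
    simpa using (hpsd j).dotProduct_mulVec_nonneg x
  have hsum : ∑ j, x j * (x ⬝ᵥ (A - Λ j) *ᵥ x) ≤ 0 := by
    simpa [sub_mulVec, hzero] using parrilo_cubic_nonneg Λ hΛsym hdiag hmix hm hx
  have hle : x i * (x ⬝ᵥ (A - Λ i) *ᵥ x) ≤ 0 :=
    (Finset.single_le_sum (f := fun j => x j * (x ⬝ᵥ (A - Λ j) *ᵥ x))
      (fun j _ => mul_nonneg (hx j) (hpsd_nonneg j)) (Finset.mem_univ i)).trans hsum
  refine ((hpsd i).dotProduct_mulVec_zero_iff x).1 ?_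
  rw [star_trivial]
  exact le_antisymm (nonpos_of_mul_nonpos_right hle hi) (hpsd_nonneg i)

/-- If the complementary index set of `u` contains the support of `v`, then `v` is orthogonal
to `A *ᵥ u`. -/
lemma dotProduct_mulVec_eq_zero_of_supp_subset {n : ℕ} {A : Matrix (Fin n) (Fin n) ℝ}
    {u v : Fin n → ℝ} (hv : ∀ i, 0 ≤ v i) (h : supp v ⊆ compSet A u) : v ⬝ᵥ A *ᵥ u = 0 := by
  refine Finset.sum_eq_zero fun i _ => ?_
  rcases (hv i).eq_or_lt with h0 | h0
  · rw [← h0, zero_mul]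
  · rw [show (A *ᵥ u) i = 0 from h h0, mul_zero]

theorem parrilo_minimal_zeros_kernel
    (n : ℕ) (A : Matrix (Fin n) (Fin n) ℝ) (hA : A ∈ Copositive n)
    (Λ : Fin n → Matrix (Fin n) (Fin n) ℝ)
    (hΛsym : ∀ i, (Λ i).IsSymm)
    (hpsd : ∀ i, (A - Λ i).PosSemidef)
    (hdiag : ∀ i, Λ i i i = 0)
    (hmix : ∀ i j : Fin n, i ≠ j → Λ i j j + 2 * Λ j i j = 0)
    (hm : ∀ i j k : Fin n, i ≠ j → i ≠ k → j ≠ k →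
      0 ≤ Λ i j k + Λ j i k + Λ k i j)
    (xα xβ : Fin n → ℝ)
    (hα : IsMinimalZero A xα) (hβ : IsMinimalZero A xβ)
    (hsupp : supp xα ∪ supp xβ ⊆ compSet A xα ∩ compSet A xβ) :
    ∀ i ∈ supp xα ∪ supp xβ, (A - Λ i) *ᵥ xα = 0 := by
  obtain ⟨⟨-, hα0, hαz⟩, -⟩ := hα
  obtain ⟨⟨-, hβ0, hβz⟩, -⟩ := hβ
  have hβα : xβ ⬝ᵥ A *ᵥ xα = 0 :=
    dotProduct_mulVec_eq_zero_of_supp_subset hβ0 fun i hi => (hsupp (Or.inr hi)).1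
  have hαβ : xα ⬝ᵥ A *ᵥ xβ = 0 :=
    dotProduct_mulVec_eq_zero_of_supp_subset hα0 fun i hi => (hsupp (Or.inl hi)).2
  intro i hi
  have hcomb : ∀ t : ℝ, 0 < t → (A - Λ i) *ᵥ xα + t • (A - Λ i) *ᵥ xβ = 0 := by
    intro t ht
    rw [← mulVec_smul, ← mulVec_add]
    refine parrilo_mulVec_eq_zero Λ hΛsym hpsd hdiag hmix hm (x := xα + t • xβ)
      (fun j => add_nonneg (hα0 j) (mul_nonneg ht.le (hβ0 j))) ?_ ?_
    · simp [mulVec_add, mulVec_smul, add_dotProduct, hαz, hβz, hαβ, hβα]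
    · rcases hi with hi | hi
      · exact add_pos_of_pos_of_nonneg hi (mul_nonneg ht.le (hβ0 i))
      · exact add_pos_of_nonneg_of_pos (hα0 i) (mul_pos ht hi)
  funext j
  have h1 := congrFun (hcomb 1 one_pos) j
  have h2 := congrFun (hcomb 2 two_pos) j
  simp only [Pi.add_apply, Pi.smul_apply, smul_eq_mul, Pi.zero_apply] at h1 h2 ⊢
  linarith
end

section
/- Let Λ¹,…,Λⁿ be real symmetric n×n matrices such that Λⁱ_{ii} = 0 for all i, Λⁱ_{jj} + 2Λʲ_{ij} = 0 for all i ≠ j, and Λⁱ_{jk} + Λʲ_{ik} + Λᵏ_{ij} ≥ 0 for all pairwise distinct i, j, k. Then for every entrywise nonnegative vector x ∈ ℝⁿ one has ∑_{i,j,k=1}^{n} Λⁱ_{jk} xᵢ xⱼ xₖ ≥ 0. -/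
open Matrix

/-- Averaging a cubic form over the three choices of the distinguished index. -/
theorem three_mul_cubic_sum {ι : Type*} [Fintype ι] (Λ : ι → Matrix ι ι ℝ) (x : ι → ℝ) :
    3 * ∑ i, ∑ j, ∑ k, Λ i j k * x i * x j * x k =
      ∑ i, ∑ j, ∑ k, (Λ i j k + Λ j i k + Λ k i j) * (x i * x j * x k) := by
  have h₁ : ∑ i, ∑ j, ∑ k, Λ j i k * (x i * x j * x k) =
      ∑ i, ∑ j, ∑ k, Λ i j k * x i * x j * x k := by
    rw [Finset.sum_comm]
    refine Finset.sum_congr rfl fun i _ => Finset.sum_congr rfl fun j _ =>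
      Finset.sum_congr rfl fun k _ => ?_
    ring
  have h₂ : ∑ i, ∑ j, ∑ k, Λ k i j * (x i * x j * x k) =
      ∑ i, ∑ j, ∑ k, Λ j i k * (x i * x j * x k) := by
    refine Finset.sum_congr rfl fun i _ => ?_
    rw [Finset.sum_comm]
    refine Finset.sum_congr rfl fun j _ => Finset.sum_congr rfl fun k _ => ?_
    ring
  simp only [add_mul, Finset.sum_add_distrib]
  rw [h₂, h₁]
  simp only [← mul_assoc]
  ring

theorem parrilo_cubic_form_nonneg
    (n : ℕ) (Λ : Fin n → Matrix (Fin n) (Fin n) ℝ)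
    (hΛsym : ∀ i, (Λ i).IsSymm)
    (hdiag : ∀ i, Λ i i i = 0)
    (hmix : ∀ i j : Fin n, i ≠ j → Λ i j j + 2 * Λ j i j = 0)
    (hm : ∀ i j k : Fin n, i ≠ j → i ≠ k → j ≠ k →
      0 ≤ Λ i j k + Λ j i k + Λ k i j)
    (x : Fin n → ℝ) (hx : ∀ i, 0 ≤ x i) :
    0 ≤ ∑ i : Fin n, ∑ j : Fin n, ∑ k : Fin n, Λ i j k * x i * x j * x k := by
  have hcoeff : ∀ i j k, 0 ≤ Λ i j k + Λ j i k + Λ k i j := by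
    intro i j k
    rcases eq_or_ne i j with rfl | hij
    · rcases eq_or_ne i k with rfl | hik
      · simp [hdiag]
      · linarith [hmix k i hik.symm, (hΛsym i).apply i k]
    · rcases eq_or_ne i k with rfl | hik
      · linarith [hmix j i hij.symm, (hΛsym i).apply i j]
      · rcases eq_or_ne j k with rfl | hjk
        · linarith [hmix i j hij]
        · exact hm i j k hij hik hjk
  have hsum := three_mul_cubic_sum Λ x
  have hnonneg : 0 ≤ ∑ i, ∑ j, ∑ k, (Λ i j k + Λ j i k + Λ k i j) * (x i * x j * x k) :=
    Finset.sum_nonneg fun i _ => Finset.sum_nonneg fun j _ => Finset.sum_nonneg fun k _ =>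
      mul_nonneg (hcoeff i j k) (mul_nonneg (mul_nonneg (hx i) (hx j)) (hx k))
  linarith
end

section
/- Let A ∈ COP_n and let x, y be zeros of A such that (Ax)ᵢ = 0 for every i ∈ Supp(y). Then x + y is a zero of A and Supp(x + y) = Supp(x) ∪ Supp(y). -/
open Matrix

/-- If `A x` vanishes on the support of a nonnegative vector `y`, then `yᵀ A x = 0`. -/
theorem dotProduct_mulVec_eq_zero_of_supp {n : ℕ} {A : Matrix (Fin n) (Fin n) ℝ}
    {x y : Fin n → ℝ} (hy : ∀ i, 0 ≤ y i) (h : ∀ i ∈ supp y, (A *ᵥ x) i = 0) :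
    y ⬝ᵥ A *ᵥ x = 0 := by
  refine Finset.sum_eq_zero fun i _ => ?_
  rcases (hy i).eq_or_lt with hi | hi
  · rw [← hi, zero_mul]
  · rw [h i hi, mul_zero]

theorem supp_add {n : ℕ} {x y : Fin n → ℝ} (hx : ∀ i, 0 ≤ x i) (hy : ∀ i, 0 ≤ y i) :
    supp (x + y) = supp x ∪ supp y := by
  ext i
  have hxi := hx i
  have hyi := hy i
  simp only [supp, Set.mem_ofPred_eq, Set.mem_union, Pi.add_apply]
  grind

theorem sum_of_orthogonal_zeros_is_zero
    (n : ℕ) (A : Matrix (Fin n) (Fin n) ℝ) (hA : A ∈ Copositive n)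
    (x y : Fin n → ℝ) (hx : IsZeroOf A x) (hy : IsZeroOf A y)
    (horth : ∀ i ∈ supp y, (A *ᵥ x) i = 0) :
    IsZeroOf A (x + y) ∧ supp (x + y) = supp x ∪ supp y := by
  obtain ⟨hx0, hxn, hxz⟩ := hx
  obtain ⟨-, hyn, hyz⟩ := hy
  have hyx : y ⬝ᵥ A *ᵥ x = 0 := dotProduct_mulVec_eq_zero_of_supp hyn horth
  have hxy : x ⬝ᵥ A *ᵥ y = 0 := by
    rw [dotProduct_mulVec, ← mulVec_transpose, hA.1.eq, dotProduct_comm, hyx]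
  refine ⟨⟨fun h => hx0 ?_, fun i => add_nonneg (hxn i) (hyn i), ?_⟩, supp_add hxn hyn⟩
  · ext i
    have hi := congrFun h i
    simp only [Pi.add_apply, Pi.zero_apply] at hi ⊢
    linarith [hxn i, hyn i]
  · simp [mulVec_add, hxz, hyz, hxy, hyx]
end

section
/- Let φ₁,…,φ₆ be real numbers satisfying: φᵢ > 0 for all i; φ₁+φ₂+φ₃+φ₄+φ₅+φ₆ < 2π; φᵢ+φᵢ₊₁ < π for i = 1,…,5; φ₁+φ₆ < π; φ₁+φ₂+φ₃ > φ₄+φ₅+φ₆; φ₃+φ₄+φ₅ > φ₁+φ₂+φ₆; φ₂+φ₃+φ₄ > φ₁+φ₅+φ₆; and φ₁+φ₂+φ₃+φ₄+φ₅+φ₆ ≠ π. Then each of the six vectors u¹ = (sin φ₂, sin(φ₁+φ₂), sin φ₁, 0, 0, 0), u² = (0, sin φ₃, sin(φ₂+φ₃), sin φ₂, 0, 0), u³ = (0, 0, sin φ₄, sin(φ₃+φ₄), sin φ₃, 0), u⁴ = (0, 0, 0, sin φ₅, sin(φ₄+φ₅), sin φ₄), u⁵ = (sin φ₅, 0, 0,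 0, sin φ₆, sin(φ₅+φ₆)), u⁶ = (sin(φ₁+φ₆), sin φ₆, 0, 0, 0, sin φ₁) is a minimal zero of the matrix A(φ) (case 13.1), with supports {1,2,3}, {2,3,4}, {3,4,5}, {4,5,6}, {1,5,6}, {1,2,6} respectively. -/
open Matrix Real

/-- The matrix `A(φ)` of case 13.1. -/
noncomputable def A131 (φ₁ φ₂ φ₃ φ₄ φ₅ φ₆ : ℝ) : Matrix (Fin 6) (Fin 6) ℝ :=
  !![1, -cos φ₁, cos (φ₁+φ₂), -cos (φ₁+φ₂+φ₃), cos (φ₅+φ₆), -cos φ₆;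
     -cos φ₁, 1, -cos φ₂, cos (φ₂+φ₃), -cos (φ₂+φ₃+φ₄), cos (φ₁+φ₆);
     cos (φ₁+φ₂), -cos φ₂, 1, -cos φ₃, cos (φ₃+φ₄), -cos (φ₃+φ₄+φ₅);
     -cos (φ₁+φ₂+φ₃), cos (φ₂+φ₃), -cos φ₃, 1, -cos φ₄, cos (φ₄+φ₅);
     cos (φ₅+φ₆), -cos (φ₂+φ₃+φ₄), cos (φ₃+φ₄), -cos φ₄, 1, -cos φ₅;
     -cos φ₆, cos (φ₁+φ₆), -cos (φ₃+φ₄+φ₅), cos (φ₄+φ₅), -cos φ₅, 1]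

lemma sum_eq_add_add_of_eq_zero {n : ℕ} {i j k : Fin n} (hij : i ≠ j) (hjk : j ≠ k) (hik : i ≠ k)
    {f : Fin n → ℝ} (hf : ∀ l, l ≠ i → l ≠ j → l ≠ k → f l = 0) :
    ∑ l, f l = f i + f j + f k := by
  rw [← Finset.sum_subset (Finset.subset_univ {i, j, k}) (by intro l _ hl; aesop),
    Finset.sum_insert (by simp [hij, hik]), Finset.sum_pair hjk, add_assoc]

/-- On vectors supported in `{i, j, k}`, the quadratic form of a symmetric matrix with unit diagonal
and entries `-cos a`, `-cos b`, `cos (a + b)` at `ij`, `jk`, `ik` is a sum of two squares. -/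
lemma dotProduct_mulVec_eq_sq_add_sq {n : ℕ} {A : Matrix (Fin n) (Fin n) ℝ} {i j k : Fin n}
    (hij : i ≠ j) (hjk : j ≠ k) (hik : i ≠ k) {a b : ℝ} (hdiag : ∀ l, A l l = 1)
    (hA : A.IsSymm) (hAij : A i j = -cos a) (hAjk : A j k = -cos b) (hAik : A i k = cos (a + b))
    {v : Fin n → ℝ} (hv : ∀ l, l ≠ i → l ≠ j → l ≠ k → v l = 0) :
    v ⬝ᵥ A *ᵥ v = (v i * cos a - v j + v k * cos b) ^ 2 + (v i * sin a - v k * sin b) ^ 2 := by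
  have hmul (m : Fin n) : (A *ᵥ v) m = A m i * v i + A m j * v j + A m k * v k :=
    sum_eq_add_add_of_eq_zero hij hjk hik fun l h₁ h₂ h₃ => by simp [hv l h₁ h₂ h₃]
  have hdot : v ⬝ᵥ A *ᵥ v = v i * (A *ᵥ v) i + v j * (A *ᵥ v) j + v k * (A *ᵥ v) k :=
    sum_eq_add_add_of_eq_zero hij hjk hik fun l h₁ h₂ h₃ => by simp [hv l h₁ h₂ h₃]
  rw [hdot, hmul, hmul, hmul, hdiag, hdiag, hdiag, hA.apply i j, hA.apply j k, hA.apply i k,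
    hAij, hAjk, hAik, cos_add]
  linear_combination (-(v i) ^ 2) * sin_sq_add_cos_sq a - (v k) ^ 2 * sin_sq_add_cos_sq b

lemma isMinimalZero_and_supp_eq {n : ℕ} {A : Matrix (Fin n) (Fin n) ℝ} {i j k : Fin n}
    (hij : i ≠ j) (hjk : j ≠ k) (hik : i ≠ k) {a b : ℝ} (ha : 0 < a) (hb : 0 < b) (hab : a + b < π)
    (hdiag : ∀ l, A l l = 1) (hA : A.IsSymm) (hAij : A i j = -cos a) (hAjk : A j k = -cos b)
    (hAik : A i k = cos (a + b)) {u : Fin n → ℝ} (hui : u i = sin b) (huj : u j = sin (a + b))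
    (huk : u k = sin a) (hu : ∀ l, l ≠ i → l ≠ j → l ≠ k → u l = 0) :
    IsMinimalZero A u ∧ supp u = {i, j, k} := by
  have hsa : 0 < sin a := sin_pos_of_pos_of_lt_pi ha (by linarith)
  have hsb : 0 < sin b := sin_pos_of_pos_of_lt_pi hb (by linarith)
  have hsab : 0 < sin (a + b) := sin_pos_of_pos_of_lt_pi (by linarith) hab
  have hsupp : supp u = {i, j, k} := by
    ext l
    simp only [supp, Set.mem_ofPred_eq, Set.mem_insert_iff, Set.mem_singleton_iff]
    grind
  refine ⟨⟨⟨fun h => ?_, fun l => ?_, ?_⟩, fun v ⟨hv0, hvnn, hvz⟩ hlt => ?_⟩, hsupp⟩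
  · simp [h, hsb.ne] at hui
  · grind
  · rw [dotProduct_mulVec_eq_sq_add_sq hij hjk hik hdiag hA hAij hAjk hAik hu, hui, huj, huk,
      sin_add]
    ring
  · have hoff : ∀ l, l ≠ i → l ≠ j → l ≠ k → v l = 0 := by
      intro l h₁ h₂ h₃
      by_contra h
      have hl : l ∈ supp u := hlt.1 (show 0 < v l from (hvnn l).lt_of_ne' h)
      simp [hsupp, h₁, h₂, h₃] at hl
    rw [dotProduct_mulVec_eq_sq_add_sq hij hjk hik hdiag hA hAij hAjk hAik hoff] at hvz
    have hj : v j = v i * cos a + v k * cos b := by nlinarith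
    have hik' : v i * sin a = v k * sin b := by nlinarith
    have hk : v k = v i * (sin a / sin b) := by field_simp; linarith
    have hj' : v j = v i * (sin (a + b) / sin b) := by rw [hj, hk, sin_add]; field_simp; ring
    have hi : 0 < v i := by
      refine (hvnn i).lt_of_ne' fun h => hv0 (funext fun l => ?_)
      rw [h, zero_mul] at hk hj'
      by_cases h₁ : l = i
      · simp [h₁, h]
      by_cases h₂ : l = j
      · simp [h₂, hj']
      by_cases h₃ : l = k
      · simp [h₃, hk]
      exact hoff l h₁ h₂ h₃
    refine hlt.2 ?_
    rw [hsupp]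
    rintro l (rfl | rfl | rfl)
    · exact hi
    · exact hj'.trans_gt (mul_pos hi (div_pos hsab hsb))
    · exact hk.trans_gt (mul_pos hi (div_pos hsa hsb))

lemma A131_diag (φ₁ φ₂ φ₃ φ₄ φ₅ φ₆ : ℝ) (l : Fin 6) : A131 φ₁ φ₂ φ₃ φ₄ φ₅ φ₆ l l = 1 := by
  fin_cases l <;> rfl

lemma A131_isSymm (φ₁ φ₂ φ₃ φ₄ φ₅ φ₆ : ℝ) : (A131 φ₁ φ₂ φ₃ φ₄ φ₅ φ₆).IsSymm := by
  ext l m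
  fin_cases l <;> fin_cases m <;> rfl

theorem A131_minimal_zeros
    (φ₁ φ₂ φ₃ φ₄ φ₅ φ₆ : ℝ)
    (h₁ : 0 < φ₁) (h₂ : 0 < φ₂) (h₃ : 0 < φ₃) (h₄ : 0 < φ₄) (h₅ : 0 < φ₅) (h₆ : 0 < φ₆)
    (hsum : φ₁ + φ₂ + φ₃ + φ₄ + φ₅ + φ₆ < 2 * π)
    (h12 : φ₁ + φ₂ < π) (h23 : φ₂ + φ₃ < π) (h34 : φ₃ + φ₄ < π)
    (h45 : φ₄ + φ₅ < π) (h56 : φ₅ + φ₆ < π) (h16 : φ₁ + φ₆ < π)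
    (hA : φ₁ + φ₂ + φ₃ > φ₄ + φ₅ + φ₆)
    (hB : φ₃ + φ₄ + φ₅ > φ₁ + φ₂ + φ₆)
    (hC : φ₂ + φ₃ + φ₄ > φ₁ + φ₅ + φ₆)
    (hne : φ₁ + φ₂ + φ₃ + φ₄ + φ₅ + φ₆ ≠ π) :
    (IsMinimalZero (A131 φ₁ φ₂ φ₃ φ₄ φ₅ φ₆) ![sin φ₂, sin (φ₁+φ₂), sin φ₁, 0, 0, 0] ∧
      supp ![sin φ₂, sin (φ₁+φ₂), sin φ₁, 0, 0, 0] = ({0, 1, 2} : Set (Fin 6))) ∧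
    (IsMinimalZero (A131 φ₁ φ₂ φ₃ φ₄ φ₅ φ₆) ![0, sin φ₃, sin (φ₂+φ₃), sin φ₂, 0, 0] ∧
      supp ![0, sin φ₃, sin (φ₂+φ₃), sin φ₂, 0, 0] = ({1, 2, 3} : Set (Fin 6))) ∧
    (IsMinimalZero (A131 φ₁ φ₂ φ₃ φ₄ φ₅ φ₆) ![0, 0, sin φ₄, sin (φ₃+φ₄), sin φ₃, 0] ∧
      supp ![0, 0, sin φ₄, sin (φ₃+φ₄), sin φ₃, 0] = ({2, 3, 4} : Set (Fin 6))) ∧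
    (IsMinimalZero (A131 φ₁ φ₂ φ₃ φ₄ φ₅ φ₆) ![0, 0, 0, sin φ₅, sin (φ₄+φ₅), sin φ₄] ∧
      supp ![0, 0, 0, sin φ₅, sin (φ₄+φ₅), sin φ₄] = ({3, 4, 5} : Set (Fin 6))) ∧
    (IsMinimalZero (A131 φ₁ φ₂ φ₃ φ₄ φ₅ φ₆) ![sin φ₅, 0, 0, 0, sin φ₆, sin (φ₅+φ₆)] ∧
      supp ![sin φ₅, 0, 0, 0, sin φ₆, sin (φ₅+φ₆)] = ({0, 4, 5} : Set (Fin 6))) ∧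
    (IsMinimalZero (A131 φ₁ φ₂ φ₃ φ₄ φ₅ φ₆) ![sin (φ₁+φ₆), sin φ₆, 0, 0, 0, sin φ₁] ∧
      supp ![sin (φ₁+φ₆), sin φ₆, 0, 0, 0, sin φ₁] = ({0, 1, 5} : Set (Fin 6))) := by
  refine ⟨?_, ?_, ?_, ?_, ?_, ?_⟩
  · exact isMinimalZero_and_supp_eq (i := 0) (j := 1) (k := 2) (a := φ₁) (b := φ₂) (by decide) (by decide)
      (by decide) h₁ h₂ h12
      (A131_diag _ _ _ _ _ _) (A131_isSymm _ _ _ _ _ _) rfl rfl rfl rfl rfl rfl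
      (by intro l _ _ _; fin_cases l <;> first | rfl | contradiction)
  · exact isMinimalZero_and_supp_eq (i := 1) (j := 2) (k := 3) (a := φ₂) (b := φ₃) (by decide) (by decide)
      (by decide) h₂ h₃ h23
      (A131_diag _ _ _ _ _ _) (A131_isSymm _ _ _ _ _ _) rfl rfl rfl rfl rfl rfl
      (by intro l _ _ _; fin_cases l <;> first | rfl | contradiction)
  · exact isMinimalZero_and_supp_eq (i := 2) (j := 3) (k := 4) (a := φ₃) (b := φ₄) (by decide) (by decide)
      (by decide) h₃ h₄ h34
      (A131_diag _ _ _ _ _ _) (A131_isSymm _ _ _ _ _ _) rfl rfl rfl rfl rfl rfl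
      (by intro l _ _ _; fin_cases l <;> first | rfl | contradiction)
  · exact isMinimalZero_and_supp_eq (i := 3) (j := 4) (k := 5) (a := φ₄) (b := φ₅) (by decide) (by decide)
      (by decide) h₄ h₅ h45
      (A131_diag _ _ _ _ _ _) (A131_isSymm _ _ _ _ _ _) rfl rfl rfl rfl rfl rfl
      (by intro l _ _ _; fin_cases l <;> first | rfl | contradiction)
  · rw [show ({0, 4, 5} : Set (Fin 6)) = {4, 5, 0} by grind]
    exact isMinimalZero_and_supp_eq (i := 4) (j := 5) (k := 0) (a := φ₅) (b := φ₆) (by decide) (by decide)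
      (by decide) h₅ h₆ h56
      (A131_diag _ _ _ _ _ _) (A131_isSymm _ _ _ _ _ _) rfl rfl rfl rfl rfl rfl
      (by intro l _ _ _; fin_cases l <;> first | rfl | contradiction)
  · rw [show ({0, 1, 5} : Set (Fin 6)) = {1, 0, 5} by grind]
    exact isMinimalZero_and_supp_eq (i := 1) (j := 0) (k := 5) (a := φ₁) (b := φ₆) (by decide) (by decide)
      (by decide) h₁ h₆ h16
      (A131_diag _ _ _ _ _ _) (A131_isSymm _ _ _ _ _ _) rfl rfl rfl rfl rfl rfl
      (by intro l _ _ _; fin_cases l <;> first | rfl | contradiction)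
end

section
/- Let φ₁,…,φ₆ be real numbers satisfying: φᵢ > 0 for all i; φ₁+φ₂+φ₃+φ₄+φ₅+φ₆ < 2π; φᵢ+φᵢ₊₁ < π for i = 1,…,5; φ₁+φ₆ < π; φ₁+φ₂+φ₃ > φ₄+φ₅+φ₆; φ₃+φ₄+φ₅ > φ₁+φ₂+φ₆; and φ₂+φ₃+φ₄ > φ₁+φ₅+φ₆. Let A = A(φ) (case 13.1) and let u¹,…,u⁶ be the vectors u¹ = (sin φ₂, sin(φ₁+φ₂), sin φ₁, 0, 0, 0), u² = (0, sin φ₃, sin(φ₂+φ₃), sin φ₂, 0, 0), u³ = (0, 0, sin φ₄, sin(φ₃+φ₄), sin φ₃, 0), u⁴ = (0, 0, 0, sin φ₅, sin(φ₄+φ₅), sin φ₄), u⁵ = (sin φ₅, 0, 0, 0, sin φ₆, sin(φ₅+φ₆)), u⁶ = (sin(φ₁+φ₆), sin φ₆, 0, 0, 0, sin φ₁). Then {i : (A u¹)ᵢ = 0} = {1,2,3,4}, {i : (A u²)ᵢ = 0} = {1,2,3,4,5}, {i : (A u³)ᵢ = 0} = {2,3,4,5,6}, {i : (A u⁴)ᵢ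 = 0} = {3,4,5,6}, {i : (A u⁵)ᵢ = 0} = {1,5,6}, and {i : (A u⁶)ᵢ = 0} = {1,2,6}. -/
open Matrix Real

/-- If `(a + b) / 2` and `(b - a) / 2` both lie in `(0, π)`, then `cos a ≠ cos b`. -/
lemma cos_ne_cos_of_lt {a b : ℝ} (hab : a < b) (hpos : 0 < a + b) (hsub : b - a < 2 * π)
    (hadd : a + b < 2 * π) : cos a - cos b ≠ 0 := by
  rw [cos_sub_cos]
  have h1 : 0 < sin ((a + b) / 2) := sin_pos_of_pos_of_lt_pi (by linarith) (by linarith)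
  have h2 : sin ((a - b) / 2) < 0 := sin_neg_of_neg_of_neg_pi_lt (by linarith) (by linarith)
  exact mul_ne_zero (mul_ne_zero (by norm_num) h1.ne') h2.ne

lemma A131_mulVec_first (φ₁ φ₂ φ₃ φ₄ φ₅ φ₆ : ℝ) :
    A131 φ₁ φ₂ φ₃ φ₄ φ₅ φ₆ *ᵥ ![sin φ₂, sin (φ₁+φ₂), sin φ₁, 0, 0, 0] =
      ![0, 0, 0, 0,
        sin φ₂ * (cos (φ₅ + φ₆) - cos (φ₁ + φ₂ + φ₃ + φ₄)),
        sin φ₁ * (cos (φ₁ + φ₂ + φ₆) - cos (φ₃ + φ₄ + φ₅))] := by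
  ext i
  fin_cases i <;>
    simp [A131, mulVec, dotProduct, Fin.sum_univ_succ, cos_add, sin_add] <;>
    grind [sin_sq_add_cos_sq]

lemma A131_mulVec_second (φ₁ φ₂ φ₃ φ₄ φ₅ φ₆ : ℝ) :
    A131 φ₁ φ₂ φ₃ φ₄ φ₅ φ₆ *ᵥ ![0, sin φ₃, sin (φ₂+φ₃), sin φ₂, 0, 0] =
      ![0, 0, 0, 0, 0, sin φ₃ * (cos (φ₁ + φ₆) - cos (φ₂ + φ₃ + φ₄ + φ₅))] := by
  ext i
  fin_cases i <;>
    simp [A131, mulVec, dotProduct, Fin.sum_univ_succ, cos_add, sin_add] <;>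
    grind [sin_sq_add_cos_sq]

lemma A131_mulVec_third (φ₁ φ₂ φ₃ φ₄ φ₅ φ₆ : ℝ) :
    A131 φ₁ φ₂ φ₃ φ₄ φ₅ φ₆ *ᵥ ![0, 0, sin φ₄, sin (φ₃+φ₄), sin φ₃, 0] =
      ![sin φ₃ * (cos (φ₅ + φ₆) - cos (φ₁ + φ₂ + φ₃ + φ₄)), 0, 0, 0, 0, 0] := by
  ext i
  fin_cases i <;>
    simp [A131, mulVec, dotProduct, Fin.sum_univ_succ, cos_add, sin_add] <;>
    grind [sin_sq_add_cos_sq]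

lemma A131_mulVec_fourth (φ₁ φ₂ φ₃ φ₄ φ₅ φ₆ : ℝ) :
    A131 φ₁ φ₂ φ₃ φ₄ φ₅ φ₆ *ᵥ ![0, 0, 0, sin φ₅, sin (φ₄+φ₅), sin φ₄] =
      ![sin φ₅ * (cos (φ₄ + φ₅ + φ₆) - cos (φ₁ + φ₂ + φ₃)),
        sin φ₄ * (cos (φ₁ + φ₆) - cos (φ₂ + φ₃ + φ₄ + φ₅)),
        0, 0, 0, 0] := by
  ext i
  fin_cases i <;>
    simp [A131, mulVec, dotProduct, Fin.sum_univ_succ, cos_add, sin_add] <;>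
    grind [sin_sq_add_cos_sq]

lemma A131_mulVec_fifth (φ₁ φ₂ φ₃ φ₄ φ₅ φ₆ : ℝ) :
    A131 φ₁ φ₂ φ₃ φ₄ φ₅ φ₆ *ᵥ ![sin φ₅, 0, 0, 0, sin φ₆, sin (φ₅+φ₆)] =
      ![0,
        sin φ₆ * (cos (φ₁ + φ₅ + φ₆) - cos (φ₂ + φ₃ + φ₄)),
        sin φ₅ * (cos (φ₁ + φ₂) - cos (φ₃ + φ₄ + φ₅ + φ₆)),
        sin φ₅ * (cos (φ₄ + φ₅ + φ₆) - cos (φ₁ + φ₂ + φ₃)),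
        0, 0] := by
  ext i
  fin_cases i <;>
    simp [A131, mulVec, dotProduct, Fin.sum_univ_succ, cos_add, sin_add] <;>
    grind [sin_sq_add_cos_sq]

lemma A131_mulVec_sixth (φ₁ φ₂ φ₃ φ₄ φ₅ φ₆ : ℝ) :
    A131 φ₁ φ₂ φ₃ φ₄ φ₅ φ₆ *ᵥ ![sin (φ₁+φ₆), sin φ₆, 0, 0, 0, sin φ₁] =
      ![0, 0,
        sin φ₁ * (cos (φ₁ + φ₂ + φ₆) - cos (φ₃ + φ₄ + φ₅)),
        sin φ₁ * (cos (φ₄ + φ₅) - cos (φ₁ + φ₂ + φ₃ + φ₆)),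
        sin φ₆ * (cos (φ₁ + φ₅ + φ₆) - cos (φ₂ + φ₃ + φ₄)),
        0] := by
  ext i
  fin_cases i <;>
    simp [A131, mulVec, dotProduct, Fin.sum_univ_succ, cos_add, sin_add] <;>
    grind [sin_sq_add_cos_sq]

theorem A131_complementary_supports
    (φ₁ φ₂ φ₃ φ₄ φ₅ φ₆ : ℝ)
    (h₁ : 0 < φ₁) (h₂ : 0 < φ₂) (h₃ : 0 < φ₃) (h₄ : 0 < φ₄) (h₅ : 0 < φ₅) (h₆ : 0 < φ₆)
    (hsum : φ₁ + φ₂ + φ₃ + φ₄ + φ₅ + φ₆ < 2 * π)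
    (h12 : φ₁ + φ₂ < π) (h23 : φ₂ + φ₃ < π) (h34 : φ₃ + φ₄ < π)
    (h45 : φ₄ + φ₅ < π) (h56 : φ₅ + φ₆ < π) (h16 : φ₁ + φ₆ < π)
    (hA : φ₁ + φ₂ + φ₃ > φ₄ + φ₅ + φ₆)
    (hB : φ₃ + φ₄ + φ₅ > φ₁ + φ₂ + φ₆)
    (hC : φ₂ + φ₃ + φ₄ > φ₁ + φ₅ + φ₆) :
    {i | (A131 φ₁ φ₂ φ₃ φ₄ φ₅ φ₆ *ᵥ ![sin φ₂, sin (φ₁+φ₂), sin φ₁, 0, 0, 0]) i = 0}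
        = ({0, 1, 2, 3} : Set (Fin 6)) ∧
    {i | (A131 φ₁ φ₂ φ₃ φ₄ φ₅ φ₆ *ᵥ ![0, sin φ₃, sin (φ₂+φ₃), sin φ₂, 0, 0]) i = 0}
        = ({0, 1, 2, 3, 4} : Set (Fin 6)) ∧
    {i | (A131 φ₁ φ₂ φ₃ φ₄ φ₅ φ₆ *ᵥ ![0, 0, sin φ₄, sin (φ₃+φ₄), sin φ₃, 0]) i = 0}
        = ({1, 2, 3, 4, 5} : Set (Fin 6)) ∧
    {i | (A131 φ₁ φ₂ φ₃ φ₄ φ₅ φ₆ *ᵥ ![0, 0, 0, sin φ₅, sin (φ₄+φ₅), sin φ₄]) i = 0}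
        = ({2, 3, 4, 5} : Set (Fin 6)) ∧
    {i | (A131 φ₁ φ₂ φ₃ φ₄ φ₅ φ₆ *ᵥ ![sin φ₅, 0, 0, 0, sin φ₆, sin (φ₅+φ₆)]) i = 0}
        = ({0, 4, 5} : Set (Fin 6)) ∧
    {i | (A131 φ₁ φ₂ φ₃ φ₄ φ₅ φ₆ *ᵥ ![sin (φ₁+φ₆), sin φ₆, 0, 0, 0, sin φ₁]) i = 0}
        = ({0, 1, 5} : Set (Fin 6)) := by
  have s1 : sin φ₁ ≠ 0 := (sin_pos_of_pos_of_lt_pi h₁ (by linarith)).ne'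
  have s2 : sin φ₂ ≠ 0 := (sin_pos_of_pos_of_lt_pi h₂ (by linarith)).ne'
  have s3 : sin φ₃ ≠ 0 := (sin_pos_of_pos_of_lt_pi h₃ (by linarith)).ne'
  have s4 : sin φ₄ ≠ 0 := (sin_pos_of_pos_of_lt_pi h₄ (by linarith)).ne'
  have s5 : sin φ₅ ≠ 0 := (sin_pos_of_pos_of_lt_pi h₅ (by linarith)).ne'
  have s6 : sin φ₆ ≠ 0 := (sin_pos_of_pos_of_lt_pi h₆ (by linarith)).ne'
  have d56 : cos (φ₅ + φ₆) - cos (φ₁ + φ₂ + φ₃ + φ₄) ≠ 0 :=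
    cos_ne_cos_of_lt (by linarith) (by linarith) (by linarith) (by linarith)
  have d126 : cos (φ₁ + φ₂ + φ₆) - cos (φ₃ + φ₄ + φ₅) ≠ 0 :=
    cos_ne_cos_of_lt (by linarith) (by linarith) (by linarith) (by linarith)
  have d16 : cos (φ₁ + φ₆) - cos (φ₂ + φ₃ + φ₄ + φ₅) ≠ 0 :=
    cos_ne_cos_of_lt (by linarith) (by linarith) (by linarith) (by linarith)
  have d456 : cos (φ₄ + φ₅ + φ₆) - cos (φ₁ + φ₂ + φ₃) ≠ 0 :=
    cos_ne_cos_of_lt (by linarith) (by linarith) (by linarith) (by linarith)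
  have d156 : cos (φ₁ + φ₅ + φ₆) - cos (φ₂ + φ₃ + φ₄) ≠ 0 :=
    cos_ne_cos_of_lt (by linarith) (by linarith) (by linarith) (by linarith)
  have d12 : cos (φ₁ + φ₂) - cos (φ₃ + φ₄ + φ₅ + φ₆) ≠ 0 :=
    cos_ne_cos_of_lt (by linarith) (by linarith) (by linarith) (by linarith)
  have d45 : cos (φ₄ + φ₅) - cos (φ₁ + φ₂ + φ₃ + φ₆) ≠ 0 :=
    cos_ne_cos_of_lt (by linarith) (by linarith) (by linarith) (by linarith)
  rw [A131_mulVec_first, A131_mulVec_second, A131_mulVec_third,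
    A131_mulVec_fourth, A131_mulVec_fifth, A131_mulVec_sixth]
  refine ⟨?_, ?_, ?_, ?_, ?_, ?_⟩ <;> ext i <;> fin_cases i <;>
    simp [s1, s2, s3, s4, s5, s6, d56, d126, d16, d456, d156, d12, d45]
end

section
/- Let φ₁,…,φ₆ be real numbers satisfying: φᵢ > 0 for all i; φ₁+φ₂+φ₃+φ₄+φ₅+φ₆ < 2π; φᵢ+φᵢ₊₁ < π for i = 1,…,5; φ₁+φ₆ < π; φ₁+φ₂+φ₃ > φ₄+φ₅+φ₆; φ₃+φ₄+φ₅ > φ₁+φ₂+φ₆; and φ₂+φ₃+φ₄ < φ₁+φ₅+φ₆. Let A = A(φ) (case 13.2) and let u¹,…,u⁶ be the vectors u¹ = (sin φ₂, sin(φ₁+φ₂), sin φ₁, 0, 0, 0), u² = (0, sin φ₃, sin(φ₂+φ₃), sin φ₂, 0, 0), u³ = (0, 0, sin φ₄, sin(φ₃+φ₄), sin φ₃, 0), u⁴ = (0, 0, 0, sin φ₅, sin(φ₄+φ₅), sin φ₄), u⁵ = (sin φ₅, 0, 0, 0, sin φ₆, sin(φ₅+φ₆)), u⁶ = (sin(φ₁+φ₆),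 sin φ₆, 0, 0, 0, sin φ₁). Then {i : (A u¹)ᵢ = 0} = {1,2,3,4}, {i : (A u²)ᵢ = 0} = {1,2,3,4}, {i : (A u³)ᵢ = 0} = {3,4,5,6}, {i : (A u⁴)ᵢ = 0} = {3,4,5,6}, {i : (A u⁵)ᵢ = 0} = {1,2,5,6}, and {i : (A u⁶)ᵢ = 0} = {1,2,5,6}. -/
open Matrix Real

/-- The matrix `A(φ)` of case 13.2 (with `A₂₅ = −cos(φ₁+φ₅+φ₆)`). -/
noncomputable def A132 (φ₁ φ₂ φ₃ φ₄ φ₅ φ₆ : ℝ) : Matrix (Fin 6) (Fin 6) ℝ :=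
  !![1, -cos φ₁, cos (φ₁+φ₂), -cos (φ₁+φ₂+φ₃), cos (φ₅+φ₆), -cos φ₆;
     -cos φ₁, 1, -cos φ₂, cos (φ₂+φ₃), -cos (φ₁+φ₅+φ₆), cos (φ₁+φ₆);
     cos (φ₁+φ₂), -cos φ₂, 1, -cos φ₃, cos (φ₃+φ₄), -cos (φ₃+φ₄+φ₅);
     -cos (φ₁+φ₂+φ₃), cos (φ₂+φ₃), -cos φ₃, 1, -cos φ₄, cos (φ₄+φ₅);
     cos (φ₅+φ₆), -cos (φ₁+φ₅+φ₆), cos (φ₃+φ₄), -cos φ₄, 1, -cos φ₅;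
     -cos φ₆, cos (φ₁+φ₆), -cos (φ₃+φ₄+φ₅), cos (φ₄+φ₅), -cos φ₅, 1]

theorem sin_mul_cos_add_sin_mul_cos (a b θ : ℝ) :
    sin a * cos (θ + a + b) + sin b * cos θ = sin (a + b) * cos (θ + a) := by
  simp only [sin_add, cos_add]
  linear_combination (sin b * cos θ) * -sin_sq_add_cos_sq a

theorem cos_ne_cos_of_lt_s11 {x y : ℝ} (hx : 0 < x) (hxy : x < y) (hsum : x + y < 2 * π) :
    cos x ≠ cos y := by
  have hs : 0 < sin ((x + y) / 2) := sin_pos_of_pos_of_lt_pi (by linarith) (by linarith)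
  have hd : 0 < sin ((y - x) / 2) := sin_pos_of_pos_of_lt_pi (by linarith) (by linarith)
  rw [ne_comm, ← sub_ne_zero, cos_sub_cos, add_comm y x]
  exact mul_ne_zero (mul_ne_zero (by norm_num) hs.ne') hd.ne'

theorem ne_zero_of_eq_mul_cos_sub_cos {r s x y : ℝ} (hs : s ≠ 0) (hx : 0 < x) (hxy : x < y)
    (hsum : x + y < 2 * π) (h : r = s * (cos x - cos y)) : r ≠ 0 :=
  h ▸ mul_ne_zero hs (sub_ne_zero.mpr (cos_ne_cos_of_lt_s11 hx hxy hsum))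

theorem setOf_eq_zero_eq_iff {R : Type*} [Zero R] (v : Fin 6 → R) (s : Set (Fin 6)) :
    {i | v i = 0} = s ↔ (v 0 = 0 ↔ 0 ∈ s) ∧ (v 1 = 0 ↔ 1 ∈ s) ∧ (v 2 = 0 ↔ 2 ∈ s) ∧
      (v 3 = 0 ↔ 3 ∈ s) ∧ (v 4 = 0 ↔ 4 ∈ s) ∧ (v 5 = 0 ↔ 5 ∈ s) := by
  simp [Set.ext_iff, Fin.forall_fin_succ]

theorem A132_complementary_supports
    (φ₁ φ₂ φ₃ φ₄ φ₅ φ₆ : ℝ)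
    (h₁ : 0 < φ₁) (h₂ : 0 < φ₂) (h₃ : 0 < φ₃) (h₄ : 0 < φ₄) (h₅ : 0 < φ₅) (h₆ : 0 < φ₆)
    (hsum : φ₁ + φ₂ + φ₃ + φ₄ + φ₅ + φ₆ < 2 * π)
    (h12 : φ₁ + φ₂ < π) (h23 : φ₂ + φ₃ < π) (h34 : φ₃ + φ₄ < π)
    (h45 : φ₄ + φ₅ < π) (h56 : φ₅ + φ₆ < π) (h16 : φ₁ + φ₆ < π)
    (hA : φ₁ + φ₂ + φ₃ > φ₄ + φ₅ + φ₆)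
    (hB : φ₃ + φ₄ + φ₅ > φ₁ + φ₂ + φ₆)
    (hC : φ₂ + φ₃ + φ₄ < φ₁ + φ₅ + φ₆) :
    {i | (A132 φ₁ φ₂ φ₃ φ₄ φ₅ φ₆ *ᵥ ![sin φ₂, sin (φ₁+φ₂), sin φ₁, 0, 0, 0]) i = 0}
        = ({0, 1, 2, 3} : Set (Fin 6)) ∧
    {i | (A132 φ₁ φ₂ φ₃ φ₄ φ₅ φ₆ *ᵥ ![0, sin φ₃, sin (φ₂+φ₃), sin φ₂, 0, 0]) i = 0}
        = ({0, 1, 2, 3} : Set (Fin 6)) ∧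
    {i | (A132 φ₁ φ₂ φ₃ φ₄ φ₅ φ₆ *ᵥ ![0, 0, sin φ₄, sin (φ₃+φ₄), sin φ₃, 0]) i = 0}
        = ({2, 3, 4, 5} : Set (Fin 6)) ∧
    {i | (A132 φ₁ φ₂ φ₃ φ₄ φ₅ φ₆ *ᵥ ![0, 0, 0, sin φ₅, sin (φ₄+φ₅), sin φ₄]) i = 0}
        = ({2, 3, 4, 5} : Set (Fin 6)) ∧
    {i | (A132 φ₁ φ₂ φ₃ φ₄ φ₅ φ₆ *ᵥ ![sin φ₅, 0, 0, 0, sin φ₆, sin (φ₅+φ₆)]) i = 0}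
        = ({0, 1, 4, 5} : Set (Fin 6)) ∧
    {i | (A132 φ₁ φ₂ φ₃ φ₄ φ₅ φ₆ *ᵥ ![sin (φ₁+φ₆), sin φ₆, 0, 0, 0, sin φ₁]) i = 0}
        = ({0, 1, 4, 5} : Set (Fin 6)) := by
  have s₁ : sin φ₁ ≠ 0 := (sin_pos_of_pos_of_lt_pi h₁ (by linarith)).ne'
  have s₃ : sin φ₃ ≠ 0 := (sin_pos_of_pos_of_lt_pi h₃ (by linarith)).ne'
  have s₅ : sin φ₅ ≠ 0 := (sin_pos_of_pos_of_lt_pi h₅ (by linarith)).ne'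
  refine ⟨?_, ?_, ?_, ?_, ?_, ?_⟩ <;>
    simp [setOf_eq_zero_eq_iff, A132, mulVec, dotProduct, Fin.sum_univ_six] <;>
    refine ⟨?_, ?_, ?_, ?_, ?_, ?_⟩
  any_goals solve | simp only [sin_add, cos_add]; grind [sin_sq_add_cos_sq]
  · refine ne_zero_of_eq_mul_cos_sub_cos (x := φ₃ + φ₄) (y := φ₁ + φ₂ + φ₅ + φ₆)
      s₁ (by linarith) (by linarith) (by linarith) ?_
    linear_combination (norm := ring_nf) sin_mul_cos_add_sin_mul_cos φ₁ φ₂ (φ₅ + φ₆)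
  · refine ne_zero_of_eq_mul_cos_sub_cos (x := φ₁ + φ₂ + φ₆) (y := φ₃ + φ₄ + φ₅)
      s₁ (by linarith) (by linarith) (by linarith) ?_
    linear_combination (norm := ring_nf) -sin_mul_cos_add_sin_mul_cos φ₁ φ₂ φ₆
  · refine ne_zero_of_eq_mul_cos_sub_cos (x := φ₂ + φ₃ + φ₄) (y := φ₁ + φ₅ + φ₆)
      s₃ (by linarith) (by linarith) (by linarith) ?_
    linear_combination (norm := ring_nf) -sin_mul_cos_add_sin_mul_cos φ₃ φ₂ φ₄
  · refine ne_zero_of_eq_mul_cos_sub_cos (x := φ₁ + φ₆) (y := φ₂ + φ₃ + φ₄ + φ₅)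
      s₃ (by linarith) (by linarith) (by linarith) ?_
    linear_combination (norm := ring_nf) sin_mul_cos_add_sin_mul_cos φ₃ φ₂ (φ₄ + φ₅)
  · refine ne_zero_of_eq_mul_cos_sub_cos (x := φ₅ + φ₆) (y := φ₁ + φ₂ + φ₃ + φ₄)
      s₃ (by linarith) (by linarith) (by linarith) ?_
    linear_combination (norm := ring_nf) sin_mul_cos_add_sin_mul_cos φ₃ φ₄ (φ₁ + φ₂)
  · refine ne_zero_of_eq_mul_cos_sub_cos (x := φ₂ + φ₃ + φ₄) (y := φ₁ + φ₅ + φ₆)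
      s₃ (by linarith) (by linarith) (by linarith) ?_
    linear_combination (norm := ring_nf) -sin_mul_cos_add_sin_mul_cos φ₃ φ₄ φ₂
  · refine ne_zero_of_eq_mul_cos_sub_cos (x := φ₄ + φ₅ + φ₆) (y := φ₁ + φ₂ + φ₃)
      s₅ (by linarith) (by linarith) (by linarith) ?_
    linear_combination (norm := ring_nf) -sin_mul_cos_add_sin_mul_cos φ₅ φ₄ φ₆
  · refine ne_zero_of_eq_mul_cos_sub_cos (x := φ₂ + φ₃) (y := φ₁ + φ₄ + φ₅ + φ₆)
      s₅ (by linarith) (by linarith) (by linarith) ?_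
    linear_combination (norm := ring_nf) sin_mul_cos_add_sin_mul_cos φ₅ φ₄ (φ₁ + φ₆)
  · refine ne_zero_of_eq_mul_cos_sub_cos (x := φ₁ + φ₂) (y := φ₃ + φ₄ + φ₅ + φ₆)
      s₅ (by linarith) (by linarith) (by linarith) ?_
    linear_combination (norm := ring_nf) sin_mul_cos_add_sin_mul_cos φ₅ φ₆ (φ₃ + φ₄)
  · refine ne_zero_of_eq_mul_cos_sub_cos (x := φ₄ + φ₅ + φ₆) (y := φ₁ + φ₂ + φ₃)
      s₅ (by linarith) (by linarith) (by linarith) ?_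
    linear_combination (norm := ring_nf) -sin_mul_cos_add_sin_mul_cos φ₅ φ₆ φ₄
  · refine ne_zero_of_eq_mul_cos_sub_cos (x := φ₁ + φ₂ + φ₆) (y := φ₃ + φ₄ + φ₅)
      s₁ (by linarith) (by linarith) (by linarith) ?_
    linear_combination (norm := ring_nf) -sin_mul_cos_add_sin_mul_cos φ₁ φ₆ φ₂
  · refine ne_zero_of_eq_mul_cos_sub_cos (x := φ₄ + φ₅) (y := φ₁ + φ₂ + φ₃ + φ₆)
      s₁ (by linarith) (by linarith) (by linarith) ?_
    linear_combination (norm := ring_nf) sin_mul_cos_add_sin_mul_cos φ₁ φ₆ (φ₂ + φ₃)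
end

section
/- Let φ₁,…,φ₆ be real numbers satisfying: φᵢ > 0 for all i; φ₁+φ₂+φ₃+φ₄+φ₅+φ₆ < 2π; φᵢ+φᵢ₊₁ < π for i = 1,…,5; and φ₁+φ₆ < π. Then the four vectors u¹ = (sin φ₂, sin(φ₁+φ₂), sin φ₁, 0, 0, 0), u² = (0, sin φ₃, sin(φ₂+φ₃), sin φ₂, 0, 0), u³ = (0, 0, sin φ₄, sin(φ₃+φ₄), sin φ₃, 0), u⁴ = (0, 0, 0, sin φ₅, sin(φ₄+φ₅), sin φ₄) in ℝ⁶ are linearly independent. -/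
open Matrix Real

theorem minimal_zeros_linearIndependent
    (φ₁ φ₂ φ₃ φ₄ φ₅ φ₆ : ℝ)
    (h₁ : 0 < φ₁) (h₂ : 0 < φ₂) (h₃ : 0 < φ₃) (h₄ : 0 < φ₄) (h₅ : 0 < φ₅) (h₆ : 0 < φ₆)
    (hsum : φ₁ + φ₂ + φ₃ + φ₄ + φ₅ + φ₆ < 2 * π)
    (h12 : φ₁ + φ₂ < π) (h23 : φ₂ + φ₃ < π) (h34 : φ₃ + φ₄ < π)
    (h45 : φ₄ + φ₅ < π) (h56 : φ₅ + φ₆ < π) (h16 : φ₁ + φ₆ < π) :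
    LinearIndependent ℝ
      ![(![sin φ₂, sin (φ₁+φ₂), sin φ₁, 0, 0, 0] : Fin 6 → ℝ),
        ![0, sin φ₃, sin (φ₂+φ₃), sin φ₂, 0, 0],
        ![0, 0, sin φ₄, sin (φ₃+φ₄), sin φ₃, 0],
        ![0, 0, 0, sin φ₅, sin (φ₄+φ₅), sin φ₄]] := by
  have s₂ : sin φ₂ ≠ 0 := (sin_pos_of_pos_of_lt_pi h₂ (by linarith)).ne'
  have s₃ : sin φ₃ ≠ 0 := (sin_pos_of_pos_of_lt_pi h₃ (by linarith)).ne'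
  have s₄ : sin φ₄ ≠ 0 := (sin_pos_of_pos_of_lt_pi h₄ (by linarith)).ne'
  have s₅ : sin φ₅ ≠ 0 := (sin_pos_of_pos_of_lt_pi h₅ (by linarith)).ne'
  rw [Fintype.linearIndependent_iff]
  intro g hg
  have e₀ := congrFun hg 0
  have e₁ := congrFun hg 1
  have e₂ := congrFun hg 2
  have e₃ := congrFun hg 3
  simp only [Fin.sum_univ_four, Pi.add_apply, Pi.smul_apply, smul_eq_mul, Pi.zero_apply,
    Matrix.cons_val] at e₀ e₁ e₂ e₃
  have g₀ : g 0 = 0 := by simpa [s₂] using e₀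
  have g₁ : g 1 = 0 := by simpa [g₀, s₃] using e₁
  have g₂ : g 2 = 0 := by simpa [g₀, g₁, s₄] using e₂
  have g₃ : g 3 = 0 := by simpa [g₀, g₁, g₂, s₅] using e₃
  intro i
  fin_cases i
  exacts [g₀, g₁, g₂, g₃]
end

section
/- Let φ₁,…,φ₆ be real numbers satisfying: φᵢ > 0 for all i; φ₁+φ₂+φ₃+φ₄+φ₅+φ₆ < 2π; φᵢ+φᵢ₊₁ < π for i = 1,…,5; φ₁+φ₆ < π; φ₁+φ₂+φ₃ > φ₄+φ₅+φ₆; φ₃+φ₄+φ₅ > φ₁+φ₂+φ₆; and φ₂+φ₃+φ₄ > φ₁+φ₅+φ₆. Then the following two quantities are nonnegative: m₁₃₅ := [cos(φ₁+φ₂) − cos(φ₃+φ₄+φ₅+φ₆)] + [cos(φ₅+φ₆) − cos(φ₁+φ₂+φ₃+φ₄)] + [cos(φ₃+φ₄) − cos(φ₁+φ₂+φ₅+φ₆)] ≥ 0, and m₂₄₆ := [cos(φ₂+φ₃) − cos(φ₁+φ₄+φ₅+φ₆)] + [cos(φ₁+φ₆) − cos(φ₂+φ₃+φ₄+φ₅)]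 + [cos(φ₄+φ₅) − cos(φ₁+φ₂+φ₃+φ₆)] ≥ 0. -/
open Real

/-- If `x + y` lies in `[0, π]`, `|x - y| ≤ π` and `z ∈ [0, π]`, then
`sin x + sin y + sin z` is nonnegative. -/
theorem sin_add_sin_add_sin_nonneg_of_mem {x y z : ℝ} (hz : 0 ≤ z) (hzπ : z ≤ π)
    (hxy : 0 ≤ x + y) (hxyπ : x + y ≤ π) (h₁ : x - y ≤ π) (h₂ : y - x ≤ π) :
    0 ≤ sin x + sin y + sin z := by
  have hsum : sin x + sin y = 2 * sin ((x + y) / 2) * cos ((x - y) / 2) := by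
    have hx : sin x = sin ((x + y) / 2 + (x - y) / 2) := by ring_nf
    have hy : sin y = sin ((x + y) / 2 - (x - y) / 2) := by ring_nf
    rw [hx, hy, sin_add, sin_sub]
    ring
  have hsin : 0 ≤ sin ((x + y) / 2) :=
    sin_nonneg_of_nonneg_of_le_pi (by linarith) (by linarith)
  have hcos : 0 ≤ cos ((x - y) / 2) :=
    cos_nonneg_of_mem_Icc ⟨by linarith, by linarith⟩
  have hsinz : 0 ≤ sin z := sin_nonneg_of_nonneg_of_le_pi hz hzπ
  rw [hsum]
  positivity

/-- If the pairwise sums of `x`, `y`, `z` lie in `[0, π]`, then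
`sin x + sin y + sin z` is nonnegative. -/
theorem sin_add_sin_add_sin_nonneg {x y z : ℝ} (hxy : 0 ≤ x + y) (hyz : 0 ≤ y + z)
    (hxz : 0 ≤ x + z) (hxyπ : x + y ≤ π) (hyzπ : y + z ≤ π) (hxzπ : x + z ≤ π) :
    0 ≤ sin x + sin y + sin z := by
  rcases le_total 0 z with hz | hz
  · exact sin_add_sin_add_sin_nonneg_of_mem hz (by linarith) hxy hxyπ
      (by linarith) (by linarith)
  · have h := sin_add_sin_add_sin_nonneg_of_mem (x := y) (y := z) (z := x)
      (by linarith) (by linarith) hyz hyzπ (by linarith) (by linarith)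
    linarith

/-- For `a`, `b`, `c` in `[0, π]` with `a + b + c ≤ 2π`, the sum of the cosines of the pairwise
sums is at most the sum of the cosines. -/
theorem sum_cos_sub_cos_nonneg {a b c : ℝ} (ha : 0 ≤ a) (hb : 0 ≤ b) (hc : 0 ≤ c)
    (haπ : a ≤ π) (hbπ : b ≤ π) (hcπ : c ≤ π) (hsum : a + b + c ≤ 2 * π) :
    0 ≤ (cos a - cos (b + c)) + (cos b - cos (c + a)) + (cos c - cos (a + b)) := by
  have hcos (u v : ℝ) : cos u - cos v = 2 * sin ((u + v) / 2) * sin ((v - u) / 2) := by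
    rw [cos_sub_cos, ← neg_sub v u, neg_div, sin_neg]
    ring
  have hsin : 0 ≤ sin ((a + b + c) / 2) :=
    sin_nonneg_of_nonneg_of_le_pi (by linarith) (by linarith)
  have hsines := sin_add_sin_add_sin_nonneg
    (x := (b + c - a) / 2) (y := (c + a - b) / 2) (z := (a + b - c) / 2)
    (by linarith) (by linarith) (by linarith) (by linarith) (by linarith) (by linarith)
  rw [hcos a, hcos b, hcos c, ← add_assoc a b c,
    show b + (c + a) = a + b + c by ring, show c + (a + b) = a + b + c by ring]
  linarith [mul_nonneg hsin hsines]

theorem m135_m246_nonneg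
    (φ₁ φ₂ φ₃ φ₄ φ₅ φ₆ : ℝ)
    (h₁ : 0 < φ₁) (h₂ : 0 < φ₂) (h₃ : 0 < φ₃) (h₄ : 0 < φ₄) (h₅ : 0 < φ₅) (h₆ : 0 < φ₆)
    (hsum : φ₁ + φ₂ + φ₃ + φ₄ + φ₅ + φ₆ < 2 * π)
    (h12 : φ₁ + φ₂ < π) (h23 : φ₂ + φ₃ < π) (h34 : φ₃ + φ₄ < π)
    (h45 : φ₄ + φ₅ < π) (h56 : φ₅ + φ₆ < π) (h16 : φ₁ + φ₆ < π)
    (hA : φ₁ + φ₂ + φ₃ > φ₄ + φ₅ + φ₆)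
    (hB : φ₃ + φ₄ + φ₅ > φ₁ + φ₂ + φ₆)
    (hC : φ₂ + φ₃ + φ₄ > φ₁ + φ₅ + φ₆) :
    0 ≤ (cos (φ₁+φ₂) - cos (φ₃+φ₄+φ₅+φ₆)) + (cos (φ₅+φ₆) - cos (φ₁+φ₂+φ₃+φ₄)) +
        (cos (φ₃+φ₄) - cos (φ₁+φ₂+φ₅+φ₆)) ∧
    0 ≤ (cos (φ₂+φ₃) - cos (φ₁+φ₄+φ₅+φ₆)) + (cos (φ₁+φ₆) - cos (φ₂+φ₃+φ₄+φ₅)) +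
        (cos (φ₄+φ₅) - cos (φ₁+φ₂+φ₃+φ₆)) := by
  constructor
  · have h := sum_cos_sub_cos_nonneg (a := φ₁ + φ₂) (b := φ₅ + φ₆) (c := φ₃ + φ₄)
      (by linarith) (by linarith) (by linarith) h12.le h56.le h34.le (by linarith)
    ring_nf at h ⊢
    linarith
  · have h := sum_cos_sub_cos_nonneg (a := φ₂ + φ₃) (b := φ₁ + φ₆) (c := φ₄ + φ₅)
      (by linarith) (by linarith) (by linarith) h23.le h16.le h45.le (by linarith)
    ring_nf at h ⊢
    linarith
end

section
/- Let M be the symmetric 6×6 matrix with unit diagonal and upper-triangular entries M₁₂ = −cos(0.20π), M₁₃ = cos(0.49π), M₁₄ = −cos(0.79π), M₁₅ = cos(0.08π), M₁₆ = −cos(0.02π), M₂₃ = −cos(0.29π), M₂₄ = cos(0.59π), M₂₅ = −cos(0.82π), M₂₆ = cos(0.22π), M₃₄ = −cos(0.30π), M₃₅ = cos(0.53π), M₃₆ = −cos(0.59π), M₄₅ = −cos(0.23π), M₄₆ = cos(0.29π), M₅₆ = −cos(0.06π). Then M belongs to the copositive cone COP_6, has unit diagonal, and does not belong to the Parrilo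 cone K_6^(1). In particular, there exist matrices with unit diagonal in COP_6 \ K_6^(1). -/
open Matrix Real

/-- The Parrilo cone `K_n^{(1)}`. -/
def ParriloK1 (n : ℕ) : Set (Matrix (Fin n) (Fin n) ℝ) :=
  {A | ∃ Λ : Fin n → Matrix (Fin n) (Fin n) ℝ,
    (∀ i, (Λ i).IsSymm) ∧
    (∀ i, (A - Λ i).PosSemidef) ∧
    (∀ i, Λ i i i = 0) ∧
    (∀ i j : Fin n, i ≠ j → Λ i j j + 2 * Λ j i j = 0) ∧
    (∀ i j k : Fin n, i ≠ j → i ≠ k → j ≠ k → 0 ≤ Λ i j k + Λ j i k + Λ k i j)}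

/-- The counterexample matrix. -/
noncomputable def Mex : Matrix (Fin 6) (Fin 6) ℝ :=
  !![1, -cos (0.20*π), cos (0.49*π), -cos (0.79*π), cos (0.08*π), -cos (0.02*π);
     -cos (0.20*π), 1, -cos (0.29*π), cos (0.59*π), -cos (0.82*π), cos (0.22*π);
     cos (0.49*π), -cos (0.29*π), 1, -cos (0.30*π), cos (0.53*π), -cos (0.59*π);
     -cos (0.79*π), cos (0.59*π), -cos (0.30*π), 1, -cos (0.23*π), cos (0.29*π);
     cos (0.08*π), -cos (0.82*π), cos (0.53*π), -cos (0.23*π), 1, -cos (0.06*π);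
     -cos (0.02*π), cos (0.22*π), -cos (0.59*π), cos (0.29*π), -cos (0.06*π), 1]
/-- Rational approximations of the cosine and sine of `k * π`, with a common error. -/
def CosSinNear (k C S e : ℝ) : Prop :=
  |cos (k * π) - C| ≤ e ∧ |sin (k * π) - S| ≤ e

lemma abs_mul_sub_mul_le {a b A B e f : ℝ} (ha : |a - A| ≤ e) (hb : |b - B| ≤ f)
    (hA : |A| ≤ 1) (hb1 : |b| ≤ 1) : |a * b - A * B| ≤ e + f := by
  have h : a * b - A * B = (a - A) * b + A * (b - B) := by ring
  rw [h]
  refine (abs_add_le _ _).trans (add_le_add ?_ ?_)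
  · rw [abs_mul]
    exact (mul_le_of_le_one_right (abs_nonneg _) hb1).trans ha
  · rw [abs_mul]
    exact (mul_le_of_le_one_left (abs_nonneg _) hA).trans hb

lemma CosSinNear.add {a b C₁ S₁ e₁ C₂ S₂ e₂ k C S e : ℝ} (h₁ : CosSinNear a C₁ S₁ e₁)
    (h₂ : CosSinNear b C₂ S₂ e₂) (hC₁ : |C₁| ≤ 1) (hS₁ : |S₁| ≤ 1) (hk : a + b = k)
    (hC : |C₁ * C₂ - S₁ * S₂ - C| ≤ e - 2 * (e₁ + e₂))
    (hS : |S₁ * C₂ + C₁ * S₂ - S| ≤ e - 2 * (e₁ + e₂)) : CosSinNear k C S e := by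
  have hcc := abs_le.1 (abs_mul_sub_mul_le h₁.1 h₂.1 hC₁ (abs_cos_le_one _))
  have hss := abs_le.1 (abs_mul_sub_mul_le h₁.2 h₂.2 hS₁ (abs_sin_le_one _))
  have hsc := abs_le.1 (abs_mul_sub_mul_le h₁.2 h₂.1 hS₁ (abs_cos_le_one _))
  have hcs := abs_le.1 (abs_mul_sub_mul_le h₁.1 h₂.2 hC₁ (abs_sin_le_one _))
  have hC' := abs_le.1 hC
  have hS' := abs_le.1 hS
  subst hk
  refine ⟨?_, ?_⟩
  · rw [add_mul, cos_add, abs_le]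
    constructor <;> linarith
  · rw [add_mul, sin_add, abs_le]
    constructor <;> linarith

lemma cosSin_taylor_bound {x : ℝ} (hx : |x| ≤ 1) :
    |cos x - (1 - x ^ 2 / 2 + x ^ 4 / 24 - x ^ 6 / 720)| ≤ |x| ^ 8 * (9 / 322560) ∧
      |sin x - (x - x ^ 3 / 6 + x ^ 5 / 120 - x ^ 7 / 5040)| ≤ |x| ^ 8 * (9 / 322560) := by
  have hn : ‖(x : ℂ) * Complex.I‖ = |x| := by simp
  have h := Complex.exp_bound (x := (x : ℂ) * Complex.I) (by rw [hn]; exact hx)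
    (n := 8) (by norm_num)
  have hs : Complex.exp (x * Complex.I) -
      ∑ m ∈ Finset.range 8, ((x : ℂ) * Complex.I) ^ m / m.factorial =
      ((cos x - (1 - x ^ 2 / 2 + x ^ 4 / 24 - x ^ 6 / 720) : ℝ) : ℂ) +
      ((sin x - (x - x ^ 3 / 6 + x ^ 5 / 120 - x ^ 7 / 5040) : ℝ) : ℂ) * Complex.I := by
    have h2 := Complex.I_sq
    have h3 : Complex.I ^ 3 = -Complex.I := Complex.I_pow_three
    have h4 := Complex.I_pow_four
    have h5 : Complex.I ^ 5 = Complex.I := by rw [pow_succ, h4, one_mul]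
    have h6 : Complex.I ^ 6 = -1 := by rw [pow_succ, h5, ← sq, h2]
    have h7 : Complex.I ^ 7 = -Complex.I := by rw [pow_succ, h6, neg_one_mul]
    rw [Complex.exp_mul_I]
    simp only [Finset.sum_range_succ, Finset.sum_range_zero, mul_pow, h2, h3, h4, h5, h6, h7,
      Nat.factorial]
    push_cast
    ring
  rw [hs, hn] at h
  have hc : |x| ^ 8 * (((8 : ℕ).succ : ℝ) * (((8 : ℕ).factorial : ℝ) * (8 : ℕ))⁻¹) =
      |x| ^ 8 * (9 / 322560) := by norm_num [Nat.factorial]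
  rw [hc] at h
  refine ⟨?_, ?_⟩
  · refine le_trans (le_of_eq ?_) ((Complex.abs_re_le_norm _).trans h)
    rw [Complex.add_re, Complex.re_ofReal_mul, Complex.ofReal_re, Complex.I_re, mul_zero, add_zero]
  · refine le_trans (le_of_eq ?_) ((Complex.abs_im_le_norm _).trans h)
    rw [Complex.add_im, Complex.im_ofReal_mul, Complex.ofReal_im, Complex.I_im, mul_one, zero_add]

lemma cosSinNear_01 : CosSinNear 0.01 0.99950656036573 0.03141075907813 (1 / 10 ^ 13) := by
  have h₁ := pi_gt_d20
  have h₂ := pi_lt_d20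
  have hx : |0.01 * π| ≤ 0.0315 := by
    rw [abs_of_pos (by positivity)]
    linarith
  have h8 : |0.01 * π| ^ 8 ≤ 0.0315 ^ 8 := pow_le_pow_left₀ (abs_nonneg _) hx 8
  obtain ⟨hc, hs⟩ := cosSin_taylor_bound (hx.trans (by norm_num))
  rw [abs_le] at hc hs
  have hp (n : ℕ) : (0.0314159265358979323846 : ℝ) ^ n ≤ (0.01 * π) ^ n ∧
      (0.01 * π) ^ n ≤ 0.0314159265358979323847 ^ n :=
    ⟨pow_le_pow_left₀ (by norm_num) (by linarith) n,
      pow_le_pow_left₀ (by positivity) (by linarith) n⟩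
  have p1 := hp 1
  have p2 := hp 2
  have p3 := hp 3
  have p4 := hp 4
  have p5 := hp 5
  have p6 := hp 6
  have p7 := hp 7
  norm_num at h8 p1 p2 p3 p4 p5 p6 p7
  norm_num at hc hs
  refine ⟨abs_le.2 ⟨?_, ?_⟩, abs_le.2 ⟨?_, ?_⟩⟩ <;> norm_num <;> linarith

lemma cosSinNear_02 : CosSinNear 0.02 0.998026728428272 0.062790519529313 (5 / 10 ^ 13) :=
  cosSinNear_01.add cosSinNear_01 (by norm_num [abs_le]) (by norm_num [abs_le]) (by norm_num)
    (by norm_num [abs_le]) (by norm_num [abs_le])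

lemma cosSinNear_03 : CosSinNear 0.03 0.99556196460308 0.09410831331851 (2 / 10 ^ 12) :=
  cosSinNear_02.add cosSinNear_01 (by norm_num [abs_le]) (by norm_num [abs_le]) (by norm_num)
    (by norm_num [abs_le]) (by norm_num [abs_le])

lemma cosSinNear_06 : CosSinNear 0.06 0.98228725072869 0.18738131458572 (9 / 10 ^ 12) :=
  cosSinNear_03.add cosSinNear_03 (by norm_num [abs_le]) (by norm_num [abs_le]) (by norm_num)
    (by norm_num [abs_le]) (by norm_num [abs_le])

lemma cosSinNear_08 : CosSinNear 0.08 0.9685831611286 0.2486898871649 (2 / 10 ^ 11) :=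
  cosSinNear_06.add cosSinNear_02 (by norm_num [abs_le]) (by norm_num [abs_le]) (by norm_num)
    (by norm_num [abs_le]) (by norm_num [abs_le])

lemma cosSinNear_14 : CosSinNear 0.14 0.9048270524660 0.4257792915651 (6 / 10 ^ 11) :=
  cosSinNear_08.add cosSinNear_06 (by norm_num [abs_le]) (by norm_num [abs_le]) (by norm_num)
    (by norm_num [abs_le]) (by norm_num [abs_le])

lemma cosSinNear_20 : CosSinNear 0.20 0.809016994375 0.587785252292 (2 / 10 ^ 10) :=
  cosSinNear_14.add cosSinNear_06 (by norm_num [abs_le]) (by norm_num [abs_le]) (by norm_num)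
    (by norm_num [abs_le]) (by norm_num [abs_le])

lemma cosSinNear_22 : CosSinNear 0.22 0.770513242776 0.637423989749 (5 / 10 ^ 10) :=
  cosSinNear_20.add cosSinNear_02 (by norm_num [abs_le]) (by norm_num [abs_le]) (by norm_num)
    (by norm_num [abs_le]) (by norm_num [abs_le])

lemma cosSinNear_23 : CosSinNear 0.23 0.750111069630 0.661311865324 (5 / 10 ^ 10) :=
  cosSinNear_20.add cosSinNear_03 (by norm_num [abs_le]) (by norm_num [abs_le]) (by norm_num)
    (by norm_num [abs_le]) (by norm_num [abs_le])

lemma cosSinNear_29 : CosSinNear 0.29 0.61290705365 0.79015501238 (2 / 10 ^ 9) :=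
  cosSinNear_23.add cosSinNear_06 (by norm_num [abs_le]) (by norm_num [abs_le]) (by norm_num)
    (by norm_num [abs_le]) (by norm_num [abs_le])

lemma cosSinNear_30 : CosSinNear 0.30 0.58778525229 0.80901699437 (2 / 10 ^ 9) :=
  cosSinNear_22.add cosSinNear_08 (by norm_num [abs_le]) (by norm_num [abs_le]) (by norm_num)
    (by norm_num [abs_le]) (by norm_num [abs_le])

lemma cosSinNear_49 : CosSinNear 0.49 0.03141075908 0.99950656037 (5 / 10 ^ 9) :=
  cosSinNear_29.add cosSinNear_20 (by norm_num [abs_le]) (by norm_num [abs_le]) (by norm_num)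
    (by norm_num [abs_le]) (by norm_num [abs_le])

lemma cosSinNear_53 : CosSinNear 0.53 (-0.09410831332) 0.99556196460 (6 / 10 ^ 9) :=
  cosSinNear_30.add cosSinNear_23 (by norm_num [abs_le]) (by norm_num [abs_le]) (by norm_num)
    (by norm_num [abs_le]) (by norm_num [abs_le])

lemma cosSinNear_59 : CosSinNear 0.59 (-0.27899110604) 0.96029368568 (9 / 10 ^ 9) :=
  cosSinNear_30.add cosSinNear_29 (by norm_num [abs_le]) (by norm_num [abs_le]) (by norm_num)
    (by norm_num [abs_le]) (by norm_num [abs_le])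

lemma cosSinNear_79 : CosSinNear 0.79 (-0.7901550124) 0.6129070537 (2 / 10 ^ 8) :=
  cosSinNear_59.add cosSinNear_20 (by norm_num [abs_le]) (by norm_num [abs_le]) (by norm_num)
    (by norm_num [abs_le]) (by norm_num [abs_le])

lemma cosSinNear_82 : CosSinNear 0.82 (-0.8443279255) 0.5358267950 (2 / 10 ^ 8) :=
  cosSinNear_53.add cosSinNear_29 (by norm_num [abs_le]) (by norm_num [abs_le]) (by norm_num)
    (by norm_num [abs_le]) (by norm_num [abs_le])

lemma Matrix.PosSemidef.sum_mul_nonneg {n : ℕ} {B : Matrix (Fin n) (Fin n) ℝ}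
    (hB : B.PosSemidef) (d : Fin n → ℝ) (L : Fin n → Fin n → ℝ) (hd : ∀ l, 0 ≤ d l) :
    0 ≤ ∑ j, ∑ k, (∑ l, d l * L l j * L l k) * B j k := by
  have h : ∑ j, ∑ k, (∑ l, d l * L l j * L l k) * B j k =
      ∑ l, d l * (L l ⬝ᵥ B *ᵥ L l) := by
    simp only [dotProduct, mulVec, Finset.mul_sum, Finset.sum_mul]
    rw [Finset.sum_comm_cycle]
    refine Finset.sum_congr rfl fun l _ => Finset.sum_congr rfl fun j _ =>
      Finset.sum_congr rfl fun k _ => ?_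
    ring
  rw [h]
  refine Finset.sum_nonneg fun l _ => mul_nonneg (hd l) ?_
  simpa using hB.dotProduct_mulVec_nonneg (L l)

/-- A symmetric tensor of order three with positive semidefinite slices and nonnegative
entries at pairwise distinct indices defines a functional that is nonnegative on the
Parrilo cone. -/
lemma ParriloK1.sum_tensor_mul_nonneg {n : ℕ} {A : Matrix (Fin n) (Fin n) ℝ}
    (hA : A ∈ ParriloK1 n) {t : Fin n → Fin n → Fin n → ℝ}
    (d : Fin n → Fin n → ℝ) (L : Fin n → Fin n → Fin n → ℝ) (hd : ∀ i l, 0 ≤ d i l)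
    (hL : ∀ i j k, t i j k = ∑ l, d i l * L i l j * L i l k)
    (h₁ : ∀ i j k, t i j k = t j i k) (h₂ : ∀ i j k, t i j k = t i k j)
    (ht : ∀ i j k, 0 ≤ t i j k) :
    0 ≤ ∑ i, ∑ j, ∑ k, t i j k * A j k := by
  obtain ⟨Λ, hsymm, hpsd, hdiag, hpair, htriple⟩ := hA
  have hslice : 0 ≤ ∑ i, ∑ j, ∑ k, t i j k * (A - Λ i) j k := by
    refine Finset.sum_nonneg fun i _ => ?_
    simp only [hL]
    exact (hpsd i).sum_mul_nonneg (d i) (L i) (hd i)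
  have hs (i j k : Fin n) : Λ i j k = Λ i k j := (hsymm i).apply k j
  have hsum (i j k : Fin n) : 0 ≤ Λ i j k + Λ j i k + Λ k i j := by
    by_cases hij : i = j
    · subst hij
      by_cases hik : i = k
      · subst hik
        simp [hdiag]
      · linarith [hpair k i (Ne.symm hik), hs i k i]
    · by_cases hik : i = k
      · subst hik
        linarith [hpair j i (Ne.symm hij), hs i j i]
      · by_cases hjk : j = k
        · subst hjk
          linarith [hpair i j hij]
        · exact htriple i j k hij hik hjk
  have hΛ : 0 ≤ ∑ i, ∑ j, ∑ k, t i j k * (Λ i j k + Λ j i k + Λ k i j) :=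
    Finset.sum_nonneg fun i _ => Finset.sum_nonneg fun j _ => Finset.sum_nonneg fun k _ =>
      mul_nonneg (ht i j k) (hsum i j k)
  have e₁ : ∑ i, ∑ j, ∑ k, t i j k * Λ j i k = ∑ i, ∑ j, ∑ k, t i j k * Λ i j k := by
    rw [Finset.sum_comm]
    simp only [h₁]
  have e₂ : ∑ i, ∑ j, ∑ k, t i j k * Λ k i j = ∑ i, ∑ j, ∑ k, t i j k * Λ j i k := by
    refine Finset.sum_congr rfl fun i _ => ?_
    rw [Finset.sum_comm]
    simp only [h₂]
  simp only [mul_add, Finset.sum_add_distrib, e₂, e₁] at hΛ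
  simp only [Matrix.sub_apply, mul_sub, Finset.sum_sub_distrib] at hslice
  linarith

/-- A symmetric tensor separating `Mex` from the Parrilo cone. -/
def sepTensor : Fin 6 → Fin 6 → Fin 6 → ℤ :=
  ![![![71732, 14954, 6663, 1199, 7556, 68026],
      ![14954, 15893, 10719, 2697, 1, 4617],
      ![6663, 10719, 7738, 2289, 1, 152],
      ![1199, 2697, 2289, 1141, 1, 44],
      ![7556, 1, 1, 1, 2776, 10439],
      ![68026, 4617, 152, 44, 10439, 74577]],
    ![![14954, 15893, 10719, 2697, 1, 4617],
      ![15893, 30443, 24923, 11602, 864, 402],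
      ![10719, 24923, 23073, 13588, 1905, 117],
      ![2697, 11602, 13588, 10705, 2160, 0],
      ![1, 864, 1905, 2160, 1054, 4],
      ![4617, 402, 117, 0, 4, 4288]],
    ![![6663, 10719, 7738, 2289, 1, 152],
      ![10719, 24923, 23073, 13588, 1905, 117],
      ![7738, 23073, 28508, 23841, 9912, 1247],
      ![2289, 13588, 23841, 25329, 14278, 2274],
      ![1, 1905, 9912, 14278, 13212, 3332],
      ![152, 117, 1247, 2274, 3332, 1587]],
    ![![1199, 2697, 2289, 1141, 1, 44],
      ![2697, 11602, 13588, 10705, 2160, 0],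
      ![2289, 13588, 23841, 25329, 14278, 2274],
      ![1141, 10705, 25329, 30919, 22814, 5221],
      ![1, 2160, 14278, 22814, 27196, 10794],
      ![44, 0, 2274, 5221, 10794, 6796]],
    ![![7556, 1, 1, 1, 2776, 10439],
      ![1, 864, 1905, 2160, 1054, 4],
      ![1, 1905, 9912, 14278, 13212, 3332],
      ![1, 2160, 14278, 22814, 27196, 10794],
      ![2776, 1054, 13212, 27196, 49568, 31852],
      ![10439, 4, 3332, 10794, 31852, 34090]],
    ![![68026, 4617, 152, 44, 10439, 74577],
      ![4617, 402, 117, 0, 4, 4288],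
      ![152, 117, 1247, 2274, 3332, 1587],
      ![44, 0, 2274, 5221, 10794, 6796],
      ![10439, 4, 3332, 10794, 31852, 34090],
      ![74577, 4288, 1587, 6796, 34090, 100000]]]

/-- The diagonal factors of the slices of `sepTensor`. -/
def sepDiag : Fin 6 → Fin 6 → ℚ :=
  ![![71732,
      229103640/17933,
      31099831843/101823840,
      42780568056763/279898486587,
      3944438224122397/42780568056763,
      5525812869658608/3944438224122397],
    ![14954,
      202657173/14954,
      380953368322/202657173,
      2295549340638/190476684161,
      431674728993299/1147774670319,
      502590479831174/431674728993299],
    ![6663,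
      17054996/2221,
      35240771311/7309284,
      41543196021760/246685399177,
      2025705108857407/41543196021760,
      18179138749401623/2025705108857407],
    ![1199,
      6636989/1199,
      43836888259/6636989,
      17267471361980/43836888259,
      2037781335241541/17267471361980,
      4515878173481798/2037781335241541],
    ![7556,
      6528383/7556,
      37288422342/6528383,
      58229862289357/37288422342,
      47102521411144/481238531317,
      271781502070110/64765966940323],
    ![68026,
      6029763/68026,
      2247612065/2009921,
      1309056792769/2247612065,
      524182319739247/3927170378307,
      1416654650736254/524182319739247]]

/-- The unit upper triangular factors of the slices of `sepTensor`. -/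
def sepUpper : Fin 6 → Fin 6 → Fin 6 → ℚ :=
  ![![![1, 7477/35866, 6663/71732, 1199/71732, 1889/17933, 34013/35866],
      ![0, 1, 111542801/152735760, 87765679/458207280, -28230173/229103640, -8575927/11455182],
      ![0, 0, 1, 119303055197/93299495529, 137089961602/93299495529, 249912538120/93299495529],
      ![0, 0, 0, 1, -111297475837564/42780568056763, -85988500820494/42780568056763],
      ![0, 0, 0, 0, 1, 3999929031595888/3944438224122397],
      ![0, 0, 0, 0, 0, 1]],
    ![![1, 15893/14954, 10719/14954, 2697/14954, 1/14954, 4617/14954],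
      ![0, 1, 202341475/202657173, 130632887/202657173, 679177/10666167, -22455491/67552391],
      ![0, 0, 1, 297171937504/190476684161, 211308662887/380953368322, 264556443765/380953368322],
      ![0, 0, 0, 1, -4415589912437/2295549340638, 2190526350799/765183113546],
      ![0, 0, 0, 0, 1, -421458912859851/431674728993299],
      ![0, 0, 0, 0, 0, 1]],
    ![![1, 3573/2221, 7738/6663, 763/2221, 1/6663, 152/6663],
      ![0, 1, 3371037/2436428, 22000351/17054996, 1056858/4263749, -283239/17054996],
      ![0, 0, 1, 54653844927/35240771311, 53191927312/35240771311, 9114118529/35240771311],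
      ![0, 0, 0, 1, 132269738407069/41543196021760, 11161832310981/4154319602176],
      ![0, 0, 0, 0, 1, 1697784835778470/2025705108857407],
      ![0, 0, 0, 0, 0, 1]],
    ![![1, 2697/1199, 21/11, 1141/1199, 1/1199, 4/109],
      ![0, 1, 10118579/6636989, 9758018/6636989, 2587143/6636989, -118668/6636989],
      ![0, 0, 1, 71301434164/43836888259, 72916888160/43836888259, 15536466738/43836888259],
      ![0, 0, 0, 1, 77634681945179/17267471361980, 9500983480149/2466781623140],
      ![0, 0, 0, 0, 1, 2032170146451277/2037781335241541],
      ![0, 0, 0, 0, 0, 1]],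
    ![![1, 1/7556, 1/7556, 1/7556, 694/1889, 10439/7556],
      ![0, 1, 14394179/6528383, 16320959/6528383, 7961248/6528383, 19785/6528383],
      ![0, 0, 1, 62120826875/37288422342, 35542210673/18644211171, 21705862439/37288422342],
      ![0, 0, 0, 1, 21768880627102/5293623844487, 195653491457665/58229862289357],
      ![0, 0, 0, 0, 1, 129771884854647/129531933880646],
      ![0, 0, 0, 0, 0, 1]],
    ![![1, 4617/68026, 76/34013, 22/34013, 10439/68026, 74577/68026],
      ![0, 1, 2419086/2009921, -67716/2009921, -47924759/6029763, -52626521/6029763],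
      ![0, 0, 1, 4577586934/2247612065, 8354436533/2247612065, 4726277874/2247612065],
      ![0, 0, 0, 1, 5165005187028/1309056792769, 4343692340984/1309056792769],
      ![0, 0, 0, 0, 1, 515438024644630/524182319739247],
      ![0, 0, 0, 0, 0, 1]]]

lemma sepDiag_nonneg : ∀ i l, 0 ≤ sepDiag i l := by decide +kernel

lemma sepTensor_nonneg : ∀ i j k, 0 ≤ sepTensor i j k := by decide +kernel

lemma sepTensor_swap_left : ∀ i j k, sepTensor i j k = sepTensor j i k := by decide +kernel

lemma sepTensor_swap_right : ∀ i j k, sepTensor i j k = sepTensor i k j := by decide +kernel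

lemma sepTensor_eq_sum : ∀ i j k,
    (sepTensor i j k : ℚ) = ∑ l, sepDiag i l * sepUpper i l j * sepUpper i l k := by decide +kernel

lemma sum_sepTensor : ∀ j k, ∑ i, sepTensor i j k =
    (![![170130, 48881, 27562, 7371, 20774, 157855],
      ![48881, 84127, 74325, 40752, 5988, 9428],
      ![27562, 74325, 94319, 81599, 42640, 8709],
      ![7371, 40752, 81599, 96129, 77243, 25129],
      ![20774, 5988, 42640, 77243, 125658, 90511],
      ![157855, 9428, 8709, 25129, 90511, 221338]] : Fin 6 → Fin 6 → ℤ) j k := by decide +kernel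

lemma Mex_notMem_ParriloK1 : Mex ∉ ParriloK1 6 := by
  intro hA
  have h := ParriloK1.sum_tensor_mul_nonneg hA (t := fun i j k => (sepTensor i j k : ℝ))
    (fun i l => (sepDiag i l : ℝ)) (fun i l j => (sepUpper i l j : ℝ))
    (fun i l => by exact_mod_cast sepDiag_nonneg i l)
    (fun i j k => by exact_mod_cast sepTensor_eq_sum i j k)
    (fun i j k => by exact_mod_cast sepTensor_swap_left i j k)
    (fun i j k => by exact_mod_cast sepTensor_swap_right i j k)
    (fun i j k => by exact_mod_cast sepTensor_nonneg i j k)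
  rw [← Finset.sum_comm_cycle] at h
  simp only [← Finset.sum_mul, ← Int.cast_sum, sum_sepTensor] at h
  simp only [Fin.sum_univ_six, Mex, Matrix.of_apply, Matrix.cons_val] at h
  push_cast at h
  have h20 := abs_le.1 cosSinNear_20.1
  have h49 := abs_le.1 cosSinNear_49.1
  have h79 := abs_le.1 cosSinNear_79.1
  have h08 := abs_le.1 cosSinNear_08.1
  have h02 := abs_le.1 cosSinNear_02.1
  have h29 := abs_le.1 cosSinNear_29.1
  have h59 := abs_le.1 cosSinNear_59.1
  have h82 := abs_le.1 cosSinNear_82.1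
  have h22 := abs_le.1 cosSinNear_22.1
  have h30 := abs_le.1 cosSinNear_30.1
  have h53 := abs_le.1 cosSinNear_53.1
  have h23 := abs_le.1 cosSinNear_23.1
  have h06 := abs_le.1 cosSinNear_06.1
  linarith

lemma cos_mul_sin_sub_add_eq_zero {d A B C S T U : ℝ} (hA : A = d ∨ A = -d)
    (hB : B = d - U ∨ B = U - d) (hC : C = d - T ∨ C = T - d) (hT : T = S + U) :
    cos (A * π) * sin (S * π) - cos (B * π) * sin (T * π) + cos (C * π) * sin (U * π) = 0 := by
  have eA : cos (A * π) = cos (d * π) := by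
    rcases hA with rfl | rfl
    · rfl
    · rw [neg_mul, cos_neg]
  have eB : cos (B * π) = cos (d * π - U * π) := by
    rcases hB with rfl | rfl
    · rw [sub_mul]
    · rw [sub_mul, ← neg_sub, cos_neg]
  have eC : cos (C * π) = cos (d * π - (S * π + U * π)) := by
    subst hT
    rcases hC with rfl | rfl
    · rw [sub_mul, add_mul]
    · rw [sub_mul, ← neg_sub, cos_neg, add_mul]
  rw [eA, eB, eC, hT, add_mul]
  simp only [cos_sub, cos_add, sin_add]
  have hU := sin_sq_add_cos_sq (U * π)
  linear_combination (-(cos (d * π) * sin (S * π))) * hU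

lemma quadForm_add_smul {n : ℕ} {A : Matrix (Fin n) (Fin n) ℝ} (hA : A.IsSymm)
    (x u : Fin n → ℝ) (t : ℝ) :
    (x + t • u) ⬝ᵥ A *ᵥ (x + t • u) =
      x ⬝ᵥ A *ᵥ x + 2 * t * (x ⬝ᵥ A *ᵥ u) + t ^ 2 * (u ⬝ᵥ A *ᵥ u) := by
  have h : u ⬝ᵥ A *ᵥ x = x ⬝ᵥ A *ᵥ u := by
    rw [dotProduct_mulVec, ← mulVec_transpose, hA.eq, dotProduct_comm]
  simp only [mulVec_add, mulVec_smul, add_dotProduct, dotProduct_add, smul_dotProduct,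
    dotProduct_smul, smul_eq_mul, h]
  ring

/-- Subtracting a multiple of a nonnegative vector `u` with `A *ᵥ u ≥ 0` does not increase the
quadratic form on the nonnegative orthant, and it can be done until a coordinate in the support
of `u` vanishes. -/
lemma exists_le_quadForm_of_mulVec_nonneg {n : ℕ} {A : Matrix (Fin n) (Fin n) ℝ}
    (hA : A.IsSymm) {u : Fin n → ℝ} (hu : ∀ i, 0 ≤ u i) (hpos : ∃ i, 0 < u i)
    (hAu : ∀ i, 0 ≤ (A *ᵥ u) i) {x : Fin n → ℝ} (hx : ∀ i, 0 ≤ x i) :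
    ∃ y : Fin n → ℝ, (∀ i, 0 ≤ y i) ∧ (∀ i, y i ≤ x i) ∧ (∃ i, u i ≠ 0 ∧ y i = 0) ∧
      y ⬝ᵥ A *ᵥ y ≤ x ⬝ᵥ A *ᵥ x := by
  obtain ⟨i₀, hi₀⟩ := hpos
  obtain ⟨i, hi, hmin⟩ := Finset.exists_min_image (Finset.univ.filter fun i => 0 < u i)
    (fun i => x i / u i) ⟨i₀, by simpa using hi₀⟩
  have hui : 0 < u i := by simpa using hi
  set t := x i / u i with ht
  have ht0 : 0 ≤ t := div_nonneg (hx i) hui.le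
  have hy : ∀ j, 0 ≤ (x - t • u) j := by
    intro j
    rcases (hu j).eq_or_lt with h | h
    · simpa [← h] using hx j
    · have := (le_div_iff₀ h).1 (hmin j (by simpa using h))
      simpa using this
  refine ⟨x - t • u, hy, fun j => ?_, ⟨i, hui.ne', ?_⟩, ?_⟩
  · simpa using mul_nonneg ht0 (hu j)
  · simp [ht, hui.ne']
  · have h := quadForm_add_smul hA (x - t • u) u t
    rw [sub_add_cancel] at h
    have h₁ : 0 ≤ (x - t • u) ⬝ᵥ A *ᵥ u :=
      Finset.sum_nonneg fun j _ => mul_nonneg (hy j) (hAu j)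
    have h₂ : 0 ≤ u ⬝ᵥ A *ᵥ u := Finset.sum_nonneg fun j _ => mul_nonneg (hu j) (hAu j)
    rw [h]
    nlinarith [mul_nonneg ht0 h₁, mul_nonneg (sq_nonneg t) h₂]

lemma path_quadForm_nonneg {a b c d p q r A₁ A₂ A₃ A₄ A₅ A₆ : ℝ} (ha : 0 ≤ a) (hb : 0 ≤ b)
    (hc : 0 ≤ c) (hd : 0 ≤ d) (hp : p ^ 2 ≤ 1) (hr : r ^ 2 ≤ 1)
    (hq : q ^ 2 ≤ (1 - p ^ 2) * (1 - r ^ 2)) (h₁ : -p ≤ A₁) (h₂ : -q ≤ A₂) (h₃ : -r ≤ A₃)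
    (h₄ : 0 ≤ A₄) (h₅ : 0 ≤ A₅) (h₆ : 0 ≤ A₆) :
    0 ≤ a ^ 2 + b ^ 2 + c ^ 2 + d ^ 2 + 2 * (A₁ * (a * b) + A₂ * (b * c) + A₃ * (c * d) +
      A₄ * (a * c) + A₅ * (a * d) + A₆ * (b * d)) := by
  have hbc : 2 * q * (b * c) ≤ (1 - p ^ 2) * b ^ 2 + (1 - r ^ 2) * c ^ 2 := by
    have hP : 0 ≤ (1 - p ^ 2) * b ^ 2 := mul_nonneg (by linarith) (sq_nonneg b)
    have hR : 0 ≤ (1 - r ^ 2) * c ^ 2 := mul_nonneg (by linarith) (sq_nonneg c)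
    have h := mul_le_mul_of_nonneg_right hq (mul_nonneg (sq_nonneg b) (sq_nonneg c))
    refine le_of_sq_le_sq ?_ (by linarith)
    nlinarith [sq_nonneg ((1 - p ^ 2) * b ^ 2 - (1 - r ^ 2) * c ^ 2)]
  have e₁ := mul_le_mul_of_nonneg_right h₁ (mul_nonneg ha hb)
  have e₂ := mul_le_mul_of_nonneg_right h₂ (mul_nonneg hb hc)
  have e₃ := mul_le_mul_of_nonneg_right h₃ (mul_nonneg hc hd)
  have e₄ := mul_nonneg h₄ (mul_nonneg ha hc)
  have e₅ := mul_nonneg h₅ (mul_nonneg ha hd)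
  have e₆ := mul_nonneg h₆ (mul_nonneg hb hd)
  nlinarith [sq_nonneg (a - p * b), sq_nonneg (d - r * c)]

lemma Mex_isSymm : Mex.IsSymm := by
  ext i j
  fin_cases i <;> fin_cases j <;> rfl

lemma Mex_mulVec_nonneg {a b c d e f : ℝ}
    (h₁ : 0 ≤ a - cos (0.20*π) * b + cos (0.49*π) * c - cos (0.79*π) * d + cos (0.08*π) * e
      - cos (0.02*π) * f)
    (h₂ : 0 ≤ -cos (0.20*π) * a + b - cos (0.29*π) * c + cos (0.59*π) * d - cos (0.82*π) * e
      + cos (0.22*π) * f)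
    (h₃ : 0 ≤ cos (0.49*π) * a - cos (0.29*π) * b + c - cos (0.30*π) * d + cos (0.53*π) * e
      - cos (0.59*π) * f)
    (h₄ : 0 ≤ -cos (0.79*π) * a + cos (0.59*π) * b - cos (0.30*π) * c + d - cos (0.23*π) * e
      + cos (0.29*π) * f)
    (h₅ : 0 ≤ cos (0.08*π) * a - cos (0.82*π) * b + cos (0.53*π) * c - cos (0.23*π) * d + e
      - cos (0.06*π) * f)
    (h₆ : 0 ≤ -cos (0.02*π) * a + cos (0.22*π) * b - cos (0.59*π) * c + cos (0.29*π) * d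
      - cos (0.06*π) * e + f) : ∀ i, 0 ≤ (Mex *ᵥ ![a, b, c, d, e, f]) i := by
  intro i
  fin_cases i <;>
    simp only [Mex, mulVec, dotProduct, Fin.sum_univ_six, Matrix.of_apply, Matrix.cons_val,
      Fin.zero_eta, Fin.mk_one, Fin.reduceFinMk]
  all_goals linarith

lemma Mex_quadForm (x : Fin 6 → ℝ) : x ⬝ᵥ Mex *ᵥ x =
    x 0 ^ 2 + x 1 ^ 2 + x 2 ^ 2 + x 3 ^ 2 + x 4 ^ 2 + x 5 ^ 2
    + 2 * (-cos (0.20*π) * (x 0 * x 1) + cos (0.49*π) * (x 0 * x 2)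
      - cos (0.79*π) * (x 0 * x 3) + cos (0.08*π) * (x 0 * x 4) - cos (0.02*π) * (x 0 * x 5)
      - cos (0.29*π) * (x 1 * x 2) + cos (0.59*π) * (x 1 * x 3) - cos (0.82*π) * (x 1 * x 4)
      + cos (0.22*π) * (x 1 * x 5) - cos (0.30*π) * (x 2 * x 3) + cos (0.53*π) * (x 2 * x 4)
      - cos (0.59*π) * (x 2 * x 5) - cos (0.23*π) * (x 3 * x 4) + cos (0.29*π) * (x 3 * x 5)
      - cos (0.06*π) * (x 4 * x 5)) := by
  simp only [Mex, mulVec, dotProduct, Fin.sum_univ_six, Matrix.of_apply, Matrix.cons_val]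
  ring

lemma exists_le_Mex_quadForm_012 {x : Fin 6 → ℝ} (hx : ∀ i, 0 ≤ x i) :
    ∃ y : Fin 6 → ℝ, (∀ i, 0 ≤ y i) ∧ (∀ i, y i ≤ x i) ∧ (y 0 = 0 ∨ y 1 = 0 ∨ y 2 = 0) ∧
      y ⬝ᵥ Mex *ᵥ y ≤ x ⬝ᵥ Mex *ᵥ x := by
  have s29 := abs_le.1 cosSinNear_29.2
  have s49 := abs_le.1 cosSinNear_49.2
  have s20 := abs_le.1 cosSinNear_20.2
  have p29 : 0 ≤ sin (0.29*π) := by linarith only [s29]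
  have p49 : 0 ≤ sin (0.49*π) := by linarith only [s49]
  have p20 : 0 ≤ sin (0.20*π) := by linarith only [s20]
  have r1 := cos_mul_sin_sub_add_eq_zero (d := 0) (A := 0) (B := 0.20) (C := 0.49)
    (S := 0.29) (T := 0.49) (U := 0.20) (by norm_num) (by norm_num) (by norm_num) (by norm_num)
  rw [zero_mul, cos_zero, one_mul] at r1
  have r2 := cos_mul_sin_sub_add_eq_zero (d := 0.20) (A := 0.20) (B := 0) (C := 0.29)
    (S := 0.29) (T := 0.49) (U := 0.20) (by norm_num) (by norm_num) (by norm_num) (by norm_num)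
  rw [zero_mul, cos_zero, one_mul] at r2
  have r3 := cos_mul_sin_sub_add_eq_zero (d := 0.49) (A := 0.49) (B := 0.29) (C := 0)
    (S := 0.29) (T := 0.49) (U := 0.20) (by norm_num) (by norm_num) (by norm_num) (by norm_num)
  rw [zero_mul, cos_zero, one_mul] at r3
  have r4 := cos_mul_sin_sub_add_eq_zero (d := 0.79) (A := 0.79) (B := 0.59) (C := 0.30)
    (S := 0.29) (T := 0.49) (U := 0.20) (by norm_num) (by norm_num) (by norm_num) (by norm_num)
  have c02 := abs_le.1 cosSinNear_02.1
  have c08 := abs_le.1 cosSinNear_08.1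
  have c22 := abs_le.1 cosSinNear_22.1
  have c53 := abs_le.1 cosSinNear_53.1
  have c59 := abs_le.1 cosSinNear_59.1
  have c82 := abs_le.1 cosSinNear_82.1
  have hAu : ∀ i, 0 ≤ (Mex *ᵥ ![sin (0.29*π), sin (0.49*π), sin (0.20*π), 0, 0, 0]) i := by
    refine Mex_mulVec_nonneg ?_ ?_ ?_ ?_ ?_ ?_
    · linarith only [r1]
    · linarith only [r2]
    · linarith only [r3]
    · linarith only [r4]
    · linarith only [s29, s49, s20, c02, c08, c22, c53, c59, c82,
        mul_le_mul_of_nonneg_right c08.1 p29,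
        mul_le_mul_of_nonneg_right c82.2 p49,
        mul_le_mul_of_nonneg_right c53.1 p20]
    · linarith only [s29, s49, s20, c02, c08, c22, c53, c59, c82,
        mul_le_mul_of_nonneg_right c02.2 p29,
        mul_le_mul_of_nonneg_right c22.1 p49,
        mul_le_mul_of_nonneg_right c59.2 p20]
  obtain ⟨y, hy, hyx, ⟨i, hui, hyi⟩, h⟩ :=
    exists_le_quadForm_of_mulVec_nonneg Mex_isSymm
      (by simp [Fin.forall_fin_succ, p29, p49, p20])
      ⟨0, show 0 < sin (0.29*π) by linarith only [s29]⟩ hAu hx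
  refine ⟨y, hy, hyx, ?_, h⟩
  clear * - hui hyi
  fin_cases i <;> simp_all

lemma exists_le_Mex_quadForm_123 {x : Fin 6 → ℝ} (hx : ∀ i, 0 ≤ x i) :
    ∃ y : Fin 6 → ℝ, (∀ i, 0 ≤ y i) ∧ (∀ i, y i ≤ x i) ∧ (y 1 = 0 ∨ y 2 = 0 ∨ y 3 = 0) ∧
      y ⬝ᵥ Mex *ᵥ y ≤ x ⬝ᵥ Mex *ᵥ x := by
  have s30 := abs_le.1 cosSinNear_30.2
  have s59 := abs_le.1 cosSinNear_59.2
  have s29 := abs_le.1 cosSinNear_29.2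
  have p30 : 0 ≤ sin (0.30*π) := by linarith only [s30]
  have p59 : 0 ≤ sin (0.59*π) := by linarith only [s59]
  have p29 : 0 ≤ sin (0.29*π) := by linarith only [s29]
  have r1 := cos_mul_sin_sub_add_eq_zero (d := -0.20) (A := 0.20) (B := 0.49) (C := 0.79)
    (S := 0.30) (T := 0.59) (U := 0.29) (by norm_num) (by norm_num) (by norm_num) (by norm_num)
  have r2 := cos_mul_sin_sub_add_eq_zero (d := 0) (A := 0) (B := 0.29) (C := 0.59)
    (S := 0.30) (T := 0.59) (U := 0.29) (by norm_num) (by norm_num) (by norm_num) (by norm_num)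
  rw [zero_mul, cos_zero, one_mul] at r2
  have r3 := cos_mul_sin_sub_add_eq_zero (d := 0.29) (A := 0.29) (B := 0) (C := 0.30)
    (S := 0.30) (T := 0.59) (U := 0.29) (by norm_num) (by norm_num) (by norm_num) (by norm_num)
  rw [zero_mul, cos_zero, one_mul] at r3
  have r4 := cos_mul_sin_sub_add_eq_zero (d := 0.59) (A := 0.59) (B := 0.30) (C := 0)
    (S := 0.30) (T := 0.59) (U := 0.29) (by norm_num) (by norm_num) (by norm_num) (by norm_num)
  rw [zero_mul, cos_zero, one_mul] at r4
  have r5 := cos_mul_sin_sub_add_eq_zero (d := 0.82) (A := 0.82) (B := 0.53) (C := 0.23)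
    (S := 0.30) (T := 0.59) (U := 0.29) (by norm_num) (by norm_num) (by norm_num) (by norm_num)
  have c22 := abs_le.1 cosSinNear_22.1
  have c29 := abs_le.1 cosSinNear_29.1
  have c59 := abs_le.1 cosSinNear_59.1
  have hAu : ∀ i, 0 ≤ (Mex *ᵥ ![0, sin (0.30*π), sin (0.59*π), sin (0.29*π), 0, 0]) i := by
    refine Mex_mulVec_nonneg ?_ ?_ ?_ ?_ ?_ ?_
    · linarith only [r1]
    · linarith only [r2]
    · linarith only [r3]
    · linarith only [r4]
    · linarith only [r5]
    · linarith only [s30, s59, s29, c22, c29, c59,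
        mul_le_mul_of_nonneg_right c22.1 p30,
        mul_le_mul_of_nonneg_right c59.2 p59,
        mul_le_mul_of_nonneg_right c29.1 p29]
  obtain ⟨y, hy, hyx, ⟨i, hui, hyi⟩, h⟩ :=
    exists_le_quadForm_of_mulVec_nonneg Mex_isSymm
      (by simp [Fin.forall_fin_succ, p30, p59, p29])
      ⟨1, show 0 < sin (0.30*π) by linarith only [s30]⟩ hAu hx
  refine ⟨y, hy, hyx, ?_, h⟩
  clear * - hui hyi
  fin_cases i <;> simp_all

lemma exists_le_Mex_quadForm_234 {x : Fin 6 → ℝ} (hx : ∀ i, 0 ≤ x i) :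
    ∃ y : Fin 6 → ℝ, (∀ i, 0 ≤ y i) ∧ (∀ i, y i ≤ x i) ∧ (y 2 = 0 ∨ y 3 = 0 ∨ y 4 = 0) ∧
      y ⬝ᵥ Mex *ᵥ y ≤ x ⬝ᵥ Mex *ᵥ x := by
  have s23 := abs_le.1 cosSinNear_23.2
  have s53 := abs_le.1 cosSinNear_53.2
  have s30 := abs_le.1 cosSinNear_30.2
  have p23 : 0 ≤ sin (0.23*π) := by linarith only [s23]
  have p53 : 0 ≤ sin (0.53*π) := by linarith only [s53]
  have p30 : 0 ≤ sin (0.30*π) := by linarith only [s30]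
  have r2 := cos_mul_sin_sub_add_eq_zero (d := -0.29) (A := 0.29) (B := 0.59) (C := 0.82)
    (S := 0.23) (T := 0.53) (U := 0.30) (by norm_num) (by norm_num) (by norm_num) (by norm_num)
  have r3 := cos_mul_sin_sub_add_eq_zero (d := 0) (A := 0) (B := 0.30) (C := 0.53)
    (S := 0.23) (T := 0.53) (U := 0.30) (by norm_num) (by norm_num) (by norm_num) (by norm_num)
  rw [zero_mul, cos_zero, one_mul] at r3
  have r4 := cos_mul_sin_sub_add_eq_zero (d := 0.30) (A := 0.30) (B := 0) (C := 0.23)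
    (S := 0.23) (T := 0.53) (U := 0.30) (by norm_num) (by norm_num) (by norm_num) (by norm_num)
  rw [zero_mul, cos_zero, one_mul] at r4
  have r5 := cos_mul_sin_sub_add_eq_zero (d := 0.53) (A := 0.53) (B := 0.23) (C := 0)
    (S := 0.23) (T := 0.53) (U := 0.30) (by norm_num) (by norm_num) (by norm_num) (by norm_num)
  rw [zero_mul, cos_zero, one_mul] at r5
  have r6 := cos_mul_sin_sub_add_eq_zero (d := 0.59) (A := 0.59) (B := 0.29) (C := 0.06)
    (S := 0.23) (T := 0.53) (U := 0.30) (by norm_num) (by norm_num) (by norm_num) (by norm_num)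
  have c08 := abs_le.1 cosSinNear_08.1
  have c49 := abs_le.1 cosSinNear_49.1
  have c79 := abs_le.1 cosSinNear_79.1
  have hAu : ∀ i, 0 ≤ (Mex *ᵥ ![0, 0, sin (0.23*π), sin (0.53*π), sin (0.30*π), 0]) i := by
    refine Mex_mulVec_nonneg ?_ ?_ ?_ ?_ ?_ ?_
    · linarith only [s23, s53, s30, c08, c49, c79,
        mul_le_mul_of_nonneg_right c49.1 p23,
        mul_le_mul_of_nonneg_right c79.2 p53,
        mul_le_mul_of_nonneg_right c08.1 p30]
    · linarith only [r2]
    · linarith only [r3]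
    · linarith only [r4]
    · linarith only [r5]
    · linarith only [r6]
  obtain ⟨y, hy, hyx, ⟨i, hui, hyi⟩, h⟩ :=
    exists_le_quadForm_of_mulVec_nonneg Mex_isSymm
      (by simp [Fin.forall_fin_succ, p23, p53, p30])
      ⟨2, show 0 < sin (0.23*π) by linarith only [s23]⟩ hAu hx
  refine ⟨y, hy, hyx, ?_, h⟩
  clear * - hui hyi
  fin_cases i <;> simp_all

lemma exists_le_Mex_quadForm_345 {x : Fin 6 → ℝ} (hx : ∀ i, 0 ≤ x i) :
    ∃ y : Fin 6 → ℝ, (∀ i, 0 ≤ y i) ∧ (∀ i, y i ≤ x i) ∧ (y 3 = 0 ∨ y 4 = 0 ∨ y 5 = 0) ∧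
      y ⬝ᵥ Mex *ᵥ y ≤ x ⬝ᵥ Mex *ᵥ x := by
  have s06 := abs_le.1 cosSinNear_06.2
  have s29 := abs_le.1 cosSinNear_29.2
  have s23 := abs_le.1 cosSinNear_23.2
  have p06 : 0 ≤ sin (0.06*π) := by linarith only [s06]
  have p29 : 0 ≤ sin (0.29*π) := by linarith only [s29]
  have p23 : 0 ≤ sin (0.23*π) := by linarith only [s23]
  have r3 := cos_mul_sin_sub_add_eq_zero (d := -0.30) (A := 0.30) (B := 0.53) (C := 0.59)
    (S := 0.06) (T := 0.29) (U := 0.23) (by norm_num) (by norm_num) (by norm_num) (by norm_num)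
  have r4 := cos_mul_sin_sub_add_eq_zero (d := 0) (A := 0) (B := 0.23) (C := 0.29)
    (S := 0.06) (T := 0.29) (U := 0.23) (by norm_num) (by norm_num) (by norm_num) (by norm_num)
  rw [zero_mul, cos_zero, one_mul] at r4
  have r5 := cos_mul_sin_sub_add_eq_zero (d := 0.23) (A := 0.23) (B := 0) (C := 0.06)
    (S := 0.06) (T := 0.29) (U := 0.23) (by norm_num) (by norm_num) (by norm_num) (by norm_num)
  rw [zero_mul, cos_zero, one_mul] at r5
  have r6 := cos_mul_sin_sub_add_eq_zero (d := 0.29) (A := 0.29) (B := 0.06) (C := 0)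
    (S := 0.06) (T := 0.29) (U := 0.23) (by norm_num) (by norm_num) (by norm_num) (by norm_num)
  rw [zero_mul, cos_zero, one_mul] at r6
  have c02 := abs_le.1 cosSinNear_02.1
  have c08 := abs_le.1 cosSinNear_08.1
  have c22 := abs_le.1 cosSinNear_22.1
  have c59 := abs_le.1 cosSinNear_59.1
  have c79 := abs_le.1 cosSinNear_79.1
  have c82 := abs_le.1 cosSinNear_82.1
  have hAu : ∀ i, 0 ≤ (Mex *ᵥ ![0, 0, 0, sin (0.06*π), sin (0.29*π), sin (0.23*π)]) i := by
    refine Mex_mulVec_nonneg ?_ ?_ ?_ ?_ ?_ ?_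
    · linarith only [s06, s29, s23, c02, c08, c22, c59, c79, c82,
        mul_le_mul_of_nonneg_right c79.2 p06,
        mul_le_mul_of_nonneg_right c08.1 p29,
        mul_le_mul_of_nonneg_right c02.2 p23]
    · linarith only [s06, s29, s23, c02, c08, c22, c59, c79, c82,
        mul_le_mul_of_nonneg_right c59.1 p06,
        mul_le_mul_of_nonneg_right c82.2 p29,
        mul_le_mul_of_nonneg_right c22.1 p23]
    · linarith only [r3]
    · linarith only [r4]
    · linarith only [r5]
    · linarith only [r6]
  obtain ⟨y, hy, hyx, ⟨i, hui, hyi⟩, h⟩ :=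
    exists_le_quadForm_of_mulVec_nonneg Mex_isSymm
      (by simp [Fin.forall_fin_succ, p06, p29, p23])
      ⟨3, show 0 < sin (0.06*π) by linarith only [s06]⟩ hAu hx
  refine ⟨y, hy, hyx, ?_, h⟩
  clear * - hui hyi
  fin_cases i <;> simp_all

lemma exists_le_Mex_quadForm_450 {x : Fin 6 → ℝ} (hx : ∀ i, 0 ≤ x i) :
    ∃ y : Fin 6 → ℝ, (∀ i, 0 ≤ y i) ∧ (∀ i, y i ≤ x i) ∧ (y 4 = 0 ∨ y 5 = 0 ∨ y 0 = 0) ∧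
      y ⬝ᵥ Mex *ᵥ y ≤ x ⬝ᵥ Mex *ᵥ x := by
  have s02 := abs_le.1 cosSinNear_02.2
  have s08 := abs_le.1 cosSinNear_08.2
  have s06 := abs_le.1 cosSinNear_06.2
  have p02 : 0 ≤ sin (0.02*π) := by linarith only [s02]
  have p08 : 0 ≤ sin (0.08*π) := by linarith only [s08]
  have p06 : 0 ≤ sin (0.06*π) := by linarith only [s06]
  have r1 := cos_mul_sin_sub_add_eq_zero (d := 0.08) (A := 0.08) (B := 0.02) (C := 0)
    (S := 0.02) (T := 0.08) (U := 0.06) (by norm_num) (by norm_num) (by norm_num) (by norm_num)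
  rw [zero_mul, cos_zero, one_mul] at r1
  have r5 := cos_mul_sin_sub_add_eq_zero (d := 0) (A := 0) (B := 0.06) (C := 0.08)
    (S := 0.02) (T := 0.08) (U := 0.06) (by norm_num) (by norm_num) (by norm_num) (by norm_num)
  rw [zero_mul, cos_zero, one_mul] at r5
  have r6 := cos_mul_sin_sub_add_eq_zero (d := 0.06) (A := 0.06) (B := 0) (C := 0.02)
    (S := 0.02) (T := 0.08) (U := 0.06) (by norm_num) (by norm_num) (by norm_num) (by norm_num)
  rw [zero_mul, cos_zero, one_mul] at r6
  have c20 := abs_le.1 cosSinNear_20.1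
  have c22 := abs_le.1 cosSinNear_22.1
  have c23 := abs_le.1 cosSinNear_23.1
  have c29 := abs_le.1 cosSinNear_29.1
  have c49 := abs_le.1 cosSinNear_49.1
  have c53 := abs_le.1 cosSinNear_53.1
  have c59 := abs_le.1 cosSinNear_59.1
  have c79 := abs_le.1 cosSinNear_79.1
  have c82 := abs_le.1 cosSinNear_82.1
  have hAu : ∀ i, 0 ≤ (Mex *ᵥ ![sin (0.06*π), 0, 0, 0, sin (0.02*π), sin (0.08*π)]) i := by
    refine Mex_mulVec_nonneg ?_ ?_ ?_ ?_ ?_ ?_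
    · linarith only [r1]
    · linarith only [s02, s08, s06, c20, c22, c23, c29, c49, c53, c59, c79, c82,
        mul_le_mul_of_nonneg_right c82.2 p02,
        mul_le_mul_of_nonneg_right c22.1 p08,
        mul_le_mul_of_nonneg_right c20.2 p06]
    · linarith only [s02, s08, s06, c20, c22, c23, c29, c49, c53, c59, c79, c82,
        mul_le_mul_of_nonneg_right c53.1 p02,
        mul_le_mul_of_nonneg_right c59.2 p08,
        mul_le_mul_of_nonneg_right c49.1 p06]
    · linarith only [s02, s08, s06, c20, c22, c23, c29, c49, c53, c59, c79, c82,
        mul_le_mul_of_nonneg_right c23.2 p02,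
        mul_le_mul_of_nonneg_right c29.1 p08,
        mul_le_mul_of_nonneg_right c79.2 p06]
    · linarith only [r5]
    · linarith only [r6]
  obtain ⟨y, hy, hyx, ⟨i, hui, hyi⟩, h⟩ :=
    exists_le_quadForm_of_mulVec_nonneg Mex_isSymm
      (by simp [Fin.forall_fin_succ, p02, p08, p06])
      ⟨4, show 0 < sin (0.02*π) by linarith only [s02]⟩ hAu hx
  refine ⟨y, hy, hyx, ?_, h⟩
  clear * - hui hyi
  fin_cases i <;> simp_all

lemma exists_le_Mex_quadForm_501 {x : Fin 6 → ℝ} (hx : ∀ i, 0 ≤ x i) :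
    ∃ y : Fin 6 → ℝ, (∀ i, 0 ≤ y i) ∧ (∀ i, y i ≤ x i) ∧ (y 5 = 0 ∨ y 0 = 0 ∨ y 1 = 0) ∧
      y ⬝ᵥ Mex *ᵥ y ≤ x ⬝ᵥ Mex *ᵥ x := by
  have s20 := abs_le.1 cosSinNear_20.2
  have s22 := abs_le.1 cosSinNear_22.2
  have s02 := abs_le.1 cosSinNear_02.2
  have p20 : 0 ≤ sin (0.20*π) := by linarith only [s20]
  have p22 : 0 ≤ sin (0.22*π) := by linarith only [s22]
  have p02 : 0 ≤ sin (0.02*π) := by linarith only [s02]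
  have r1 := cos_mul_sin_sub_add_eq_zero (d := 0.02) (A := 0.02) (B := 0) (C := 0.20)
    (S := 0.20) (T := 0.22) (U := 0.02) (by norm_num) (by norm_num) (by norm_num) (by norm_num)
  rw [zero_mul, cos_zero, one_mul] at r1
  have r2 := cos_mul_sin_sub_add_eq_zero (d := 0.22) (A := 0.22) (B := 0.20) (C := 0)
    (S := 0.20) (T := 0.22) (U := 0.02) (by norm_num) (by norm_num) (by norm_num) (by norm_num)
  rw [zero_mul, cos_zero, one_mul] at r2
  have r6 := cos_mul_sin_sub_add_eq_zero (d := 0) (A := 0) (B := 0.02) (C := 0.22)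
    (S := 0.20) (T := 0.22) (U := 0.02) (by norm_num) (by norm_num) (by norm_num) (by norm_num)
  rw [zero_mul, cos_zero, one_mul] at r6
  have c06 := abs_le.1 cosSinNear_06.1
  have c08 := abs_le.1 cosSinNear_08.1
  have c29 := abs_le.1 cosSinNear_29.1
  have c49 := abs_le.1 cosSinNear_49.1
  have c59 := abs_le.1 cosSinNear_59.1
  have c79 := abs_le.1 cosSinNear_79.1
  have c82 := abs_le.1 cosSinNear_82.1
  have hAu : ∀ i, 0 ≤ (Mex *ᵥ ![sin (0.22*π), sin (0.02*π), 0, 0, 0, sin (0.20*π)]) i := by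
    refine Mex_mulVec_nonneg ?_ ?_ ?_ ?_ ?_ ?_
    · linarith only [r1]
    · linarith only [r2]
    · linarith only [s20, s22, s02, c06, c08, c29, c49, c59, c79, c82,
        mul_le_mul_of_nonneg_right c59.2 p20,
        mul_le_mul_of_nonneg_right c49.1 p22,
        mul_le_mul_of_nonneg_right c29.2 p02]
    · linarith only [s20, s22, s02, c06, c08, c29, c49, c59, c79, c82,
        mul_le_mul_of_nonneg_right c29.1 p20,
        mul_le_mul_of_nonneg_right c79.2 p22,
        mul_le_mul_of_nonneg_right c59.1 p02]
    · linarith only [s20, s22, s02, c06, c08, c29, c49, c59, c79, c82,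
        mul_le_mul_of_nonneg_right c06.2 p20,
        mul_le_mul_of_nonneg_right c08.1 p22,
        mul_le_mul_of_nonneg_right c82.2 p02]
    · linarith only [r6]
  obtain ⟨y, hy, hyx, ⟨i, hui, hyi⟩, h⟩ :=
    exists_le_quadForm_of_mulVec_nonneg Mex_isSymm
      (by simp [Fin.forall_fin_succ, p20, p22, p02])
      ⟨5, show 0 < sin (0.20*π) by linarith only [s20]⟩ hAu hx
  refine ⟨y, hy, hyx, ?_, h⟩
  clear * - hui hyi
  fin_cases i <;> simp_all

lemma Mex_mem_Copositive : Mex ∈ Copositive 6 := by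
  refine ⟨Mex_isSymm, fun x hx => ?_⟩
  obtain ⟨x₁, h₁, hle₁, hz₁, hq₁⟩ := exists_le_Mex_quadForm_012 hx
  obtain ⟨x₂, h₂, hle₂, hz₂, hq₂⟩ := exists_le_Mex_quadForm_123 h₁
  obtain ⟨x₃, h₃, hle₃, hz₃, hq₃⟩ := exists_le_Mex_quadForm_234 h₂
  obtain ⟨x₄, h₄, hle₄, hz₄, hq₄⟩ := exists_le_Mex_quadForm_345 h₃
  obtain ⟨x₅, h₅, hle₅, hz₅, hq₅⟩ := exists_le_Mex_quadForm_450 h₄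
  obtain ⟨y, hy, hle₆, hz₆, hq₆⟩ := exists_le_Mex_quadForm_501 h₅
  refine le_trans ?_ (hq₆.trans (hq₅.trans (hq₄.trans (hq₃.trans (hq₂.trans hq₁)))))
  have t₅ (i) (h : x₅ i = 0) : y i = 0 := le_antisymm (h ▸ hle₆ i) (hy i)
  have t₄ (i) (h : x₄ i = 0) : y i = 0 := t₅ i (le_antisymm (h ▸ hle₅ i) (h₅ i))
  have t₃ (i) (h : x₃ i = 0) : y i = 0 := t₄ i (le_antisymm (h ▸ hle₄ i) (h₄ i))
  have t₂ (i) (h : x₂ i = 0) : y i = 0 := t₃ i (le_antisymm (h ▸ hle₃ i) (h₃ i))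
  have t₁ (i) (h : x₁ i = 0) : y i = 0 := t₂ i (le_antisymm (h ▸ hle₂ i) (h₂ i))
  replace hz₁ := hz₁.imp (t₁ 0) (Or.imp (t₁ 1) (t₁ 2))
  replace hz₂ := hz₂.imp (t₂ 1) (Or.imp (t₂ 2) (t₂ 3))
  replace hz₃ := hz₃.imp (t₃ 2) (Or.imp (t₃ 3) (t₃ 4))
  replace hz₄ := hz₄.imp (t₄ 3) (Or.imp (t₄ 4) (t₄ 5))
  replace hz₅ := hz₅.imp (t₅ 4) (Or.imp (t₅ 5) (t₅ 0))
  have hface : (y 2 = 0 ∧ y 5 = 0) ∨ (y 1 = 0 ∧ y 4 = 0) ∨ (y 0 = 0 ∧ y 3 = 0) ∨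
      (y 0 = 0 ∧ y 2 = 0 ∧ y 4 = 0) ∨ (y 1 = 0 ∧ y 3 = 0 ∧ y 5 = 0) := by
    clear * - hz₁ hz₂ hz₃ hz₄ hz₅ hz₆
    grind
  have c20 := abs_le.1 cosSinNear_20.1
  have c49 := abs_le.1 cosSinNear_49.1
  have c79 := abs_le.1 cosSinNear_79.1
  have c08 := abs_le.1 cosSinNear_08.1
  have c02 := abs_le.1 cosSinNear_02.1
  have c29 := abs_le.1 cosSinNear_29.1
  have c59 := abs_le.1 cosSinNear_59.1
  have c82 := abs_le.1 cosSinNear_82.1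
  have c22 := abs_le.1 cosSinNear_22.1
  have c30 := abs_le.1 cosSinNear_30.1
  have c53 := abs_le.1 cosSinNear_53.1
  have c23 := abs_le.1 cosSinNear_23.1
  have c06 := abs_le.1 cosSinNear_06.1
  rw [Mex_quadForm]
  rcases hface with ⟨e, f⟩ | ⟨e, f⟩ | ⟨e, f⟩ | ⟨e, f, g⟩ | ⟨e, f, g⟩
  · rw [e, f]
    have := path_quadForm_nonneg (p := 0.81) (q := 0.28) (r := 0.751) (A₁ := -cos (0.20*π))
      (A₂ := cos (0.59*π)) (A₃ := -cos (0.23*π)) (A₄ := -cos (0.79*π)) (A₅ := cos (0.08*π))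
      (A₆ := -cos (0.82*π)) (hy 0) (hy 1) (hy 3) (hy 4) (by norm_num) (by norm_num) (by norm_num)
      (by linarith only [c20]) (by linarith only [c59]) (by linarith only [c23])
      (by linarith only [c79]) (by linarith only [c08]) (by linarith only [c82])
    linarith only [this]
  · rw [e, f]
    have := path_quadForm_nonneg (p := 1) (q := 0) (r := 1) (A₁ := -cos (0.02*π))
      (A₂ := cos (0.49*π)) (A₃ := -cos (0.30*π)) (A₄ := -cos (0.59*π)) (A₅ := cos (0.29*π))
      (A₆ := -cos (0.79*π)) (hy 5) (hy 0) (hy 2) (hy 3) (by norm_num) (by norm_num) (by norm_num)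
      (by linarith only [c02]) (by linarith only [c49]) (by linarith only [c30])
      (by linarith only [c59]) (by linarith only [c29]) (by linarith only [c79])
    linarith only [this]
  · rw [e, f]
    have := path_quadForm_nonneg (p := 0.613) (q := 0.095) (r := 0.983) (A₁ := -cos (0.29*π))
      (A₂ := cos (0.53*π)) (A₃ := -cos (0.06*π)) (A₄ := -cos (0.82*π)) (A₅ := cos (0.22*π))
      (A₆ := -cos (0.59*π)) (hy 1) (hy 2) (hy 4) (hy 5) (by norm_num) (by norm_num) (by norm_num)
      (by linarith only [c29]) (by linarith only [c53]) (by linarith only [c06])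
      (by linarith only [c82]) (by linarith only [c22]) (by linarith only [c59])
    linarith only [this]
  · rw [e, f, g]
    have := path_quadForm_nonneg (p := 0.28) (q := 0) (r := 0) (A₁ := cos (0.59*π))
      (A₂ := cos (0.29*π)) (A₃ := 0) (A₄ := cos (0.22*π)) (A₅ := 0)
      (A₆ := 0) (hy 1) (hy 3) (hy 5) le_rfl (by norm_num) (by norm_num) (by norm_num)
      (by linarith only [c59]) (by linarith only [c29]) (by norm_num) (by linarith only [c22])
      (by norm_num) (by norm_num)
    linarith only [this]
  · rw [e, f, g]
    have := path_quadForm_nonneg (p := 0) (q := 0.095) (r := 0) (A₁ := cos (0.49*π))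
      (A₂ := cos (0.53*π)) (A₃ := 0) (A₄ := cos (0.08*π)) (A₅ := 0)
      (A₆ := 0) (hy 0) (hy 2) (hy 4) le_rfl (by norm_num) (by norm_num) (by norm_num)
      (by linarith only [c49]) (by linarith only [c53]) (by norm_num) (by linarith only [c08])
      (by norm_num) (by norm_num)
    linarith only [this]

theorem Mex_copositive_not_parrilo :
    Mex ∈ Copositive 6 ∧ (∀ i, Mex i i = 1) ∧ Mex ∉ ParriloK1 6 ∧
    ∃ B : Matrix (Fin 6) (Fin 6) ℝ,
      B ∈ Copositive 6 ∧ (∀ i, B i i = 1) ∧ B ∉ ParriloK1 6 := by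
  have hdiag : ∀ i, Mex i i = 1 := by
    intro i
    fin_cases i <;> rfl
  exact ⟨Mex_mem_Copositive, hdiag, Mex_notMem_ParriloK1,
    Mex, Mex_mem_Copositive, hdiag, Mex_notMem_ParriloK1⟩
end
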